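/- There exist a constant c ≥ 1 and n0 such that for every n ≥ n0 there exist positive integers u, v and subsets S_{ij} ⊆ [n] (for i ∈ [u], j ∈ [v]) with Σ_{i,j} |S_{ij}| ≤ n^{c}, such that the monotone depth-three Boolean function f:{0,1}^n → {0,1} defined by f(x) = ⋀_{i=1}^u ⋁_{j=1}^v ⋀_{k∈S_{ij}} x_k satisfies, with t = ⌈c (log₂ n)^2⌉: (i) for every t-wise independent distribution 𝒟 on {0,1}^n, |Pr_{x∼𝒟}[f(x)=1] − 1/2| ≤ 1/9, and (ii) for every integer 1 ≤ q ≤ n, I_{q,t}(f) ≤ c·((log₂ n)^2/n)·q. -/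

import Mathlib

open Finset

/-- Probability of event `E` under the uniform distribution on a finite type. -/
noncomputable def uPr {α : Type*} [Fintype α] (E : α → Prop) : ℝ :=
  (Nat.card {x // E x} : ℝ) / (Fintype.card α)

-- Probability of event `E` under the distribution with weight function `D`.
open Classical in
noncomputable def dPr {α : Type*} [Fintype α] (D : α → ℝ) (E : α → Prop) : ℝ :=
  ∑ x, if E x then D x else 0

-- `D` is a `t`-wise independent distribution: every projection to ≤ `t` coordinates is uniform.
open Classical in
def kWiseIndep {ι : Type*} [Fintype ι] (D : (ι → Bool) → ℝ) (t : ℕ) : Prop :=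
  ∀ I : Finset ι, I.card ≤ t → ∀ σ : ι → Bool,
    (∑ x : ι → Bool, if ∀ i ∈ I, x i = σ i then D x else 0) = (1/2 : ℝ) ^ I.card

/-- Monotone depth-3 (AND of ORs of ANDs) function given by subsets `S i j`. -/
def Depth3 {n u v : ℕ} (S : Fin u → Fin v → Finset (Fin n)) (x : Fin n → Bool) : Prop :=
  ∀ i, ∃ j, ∀ k ∈ S i j, x k = true

/-- The event (on assignments to coordinates outside `Q`) that `F` is not determined. -/
def UndetC {n : ℕ} (F : (Fin n → Bool) → Prop) (Q : Finset (Fin n))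
    (x : {i : Fin n // i ∉ Q} → Bool) : Prop :=
  ∃ y z : Fin n → Bool, (∀ i, ∀ h : i ∉ Q, y i = x ⟨i, h⟩) ∧
    (∀ i, ∀ h : i ∉ Q, z i = x ⟨i, h⟩) ∧ ¬(F y ↔ F z)


section Expectation

variable {ι κ : Type*} [Fintype ι] [DecidableEq ι]

/-- Indicator that all coordinates in `I` are `true`. -/
noncomputable def andInd (I : Finset ι) (x : ι → Bool) : ℝ :=
  if ∀ i ∈ I, x i = true then 1 else 0

/-- Expectation of `h` with respect to the weights `D`. -/
noncomputable def wExp {α : Type*} [Fintype α] (D h : α → ℝ) : ℝ := ∑ x, D x * h x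

/-- All conjunctions of at most `t` variables have their uniform probability. -/
def AndUniform (D : (ι → Bool) → ℝ) (t : ℕ) : Prop :=
  ∀ I : Finset ι, I.card ≤ t → wExp D (andInd I) = (1 / 2 : ℝ) ^ I.card

lemma kWiseIndep.andUniform {D : (ι → Bool) → ℝ} {t : ℕ} (h : kWiseIndep D t) :
    AndUniform D t := by
  intro I hI
  rw [← h I hI (fun _ => true)]
  refine sum_congr (by ext; simp) fun x _ => ?_
  simp [andInd]

lemma AndUniform.mono {D : (ι → Bool) → ℝ} {s t : ℕ} (h : AndUniform D t) (hst : s ≤ t) :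
    AndUniform D s := fun I hI => h I (hI.trans hst)

lemma andInd_nonneg (I : Finset ι) (x : ι → Bool) : 0 ≤ andInd I x := by
  unfold andInd; split_ifs <;> norm_num

lemma andInd_le_one (I : Finset ι) (x : ι → Bool) : andInd I x ≤ 1 := by
  unfold andInd; split_ifs <;> norm_num

lemma andInd_mul (I J : Finset ι) (x : ι → Bool) :
    andInd I x * andInd J x = andInd (I ∪ J) x := by
  simp only [andInd, mem_union, or_imp, forall_and]
  split_ifs <;> simp_all

lemma andInd_mono (I : Finset ι) : Monotone (andInd I) := by
  intro x y hxy
  unfold andInd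
  split_ifs with h1 h2
  · exact le_rfl
  · exact absurd (fun i hi => by have := hxy i; rw [h1 i hi] at this; exact top_le_iff.1 this) h2
  · norm_num
  · exact le_rfl

lemma prod_andInd (B : κ → Finset ι) (S : Finset κ) (x : ι → Bool) :
    ∏ j ∈ S, andInd (B j) x = andInd (S.biUnion B) x := by
  classical
  induction S using Finset.induction_on with
  | empty => simp [andInd]
  | insert a s ha ih => rw [prod_insert ha, ih, andInd_mul, biUnion_insert]

lemma wExp_sum {α σ : Type*} [Fintype α] (D : α → ℝ) (s : Finset σ) (h : σ → α → ℝ) :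
    wExp D (fun x => ∑ i ∈ s, h i x) = ∑ i ∈ s, wExp D (h i) := by
  simp only [wExp, mul_sum]
  exact sum_comm

lemma wExp_const_mul {α : Type*} [Fintype α] (D : α → ℝ) (c : ℝ) (h : α → ℝ) :
    wExp D (fun x => c * h x) = c * wExp D h := by
  simp only [wExp, mul_sum]
  exact sum_congr rfl fun x _ => by ring

lemma wExp_add {α : Type*} [Fintype α] (D g h : α → ℝ) :
    wExp D (fun x => g x + h x) = wExp D g + wExp D h := by
  simp only [wExp, ← sum_add_distrib, mul_add]

lemma wExp_sub {α : Type*} [Fintype α] (D g h : α → ℝ) :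
    wExp D (fun x => g x - h x) = wExp D g - wExp D h := by
  simp only [wExp, ← sum_sub_distrib, mul_sub]

lemma wExp_mono {α : Type*} [Fintype α] {D g h : α → ℝ} (hD : ∀ x, 0 ≤ D x)
    (hgh : ∀ x, g x ≤ h x) : wExp D g ≤ wExp D h :=
  sum_le_sum fun x _ => mul_le_mul_of_nonneg_left (hgh x) (hD x)

lemma wExp_nonneg {α : Type*} [Fintype α] {D h : α → ℝ} (hD : ∀ x, 0 ≤ D x)
    (hh : ∀ x, 0 ≤ h x) : 0 ≤ wExp D h :=
  sum_nonneg fun x _ => mul_nonneg (hD x) (hh x)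

lemma dPr_eq_wExp {α : Type*} [Fintype α] (D : α → ℝ) (E : α → Prop) [DecidablePred E] :
    dPr D E = wExp D (fun x => if E x then 1 else 0) := by
  unfold dPr wExp
  refine sum_congr rfl fun x _ => ?_
  by_cases h : E x <;> simp [h]

/-- The number of sets in the subfamily `J` all of whose coordinates are `true`. -/
def satCount (B : κ → Finset ι) (J : Finset κ) (x : ι → Bool) : ℕ :=
  #{j ∈ J | ∀ i ∈ B j, x i = true}

/-- Inclusion-exclusion sum for the event that no set of the subfamily `J` is satisfied,
truncated at level `m`. -/
noncomputable def truncIE (B : κ → Finset ι) (J : Finset κ) (m : ℕ) (x : ι → Bool) : ℝ :=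
  ∑ i ∈ range (m + 1), (-1) ^ i * ∑ S ∈ powersetCard i J, andInd (S.biUnion B) x

lemma sum_powersetCard_andInd (B : κ → Finset ι) (J : Finset κ) (i : ℕ) (x : ι → Bool) :
    ∑ S ∈ powersetCard i J, andInd (S.biUnion B) x = (satCount B J x).choose i := by
  classical
  unfold satCount
  rw [← card_powersetCard]
  have : ∀ S ∈ powersetCard i J, andInd (S.biUnion B) x =
      if S ⊆ {j ∈ J | ∀ i ∈ B j, x i = true} then 1 else 0 := by
    intro S hS
    rw [mem_powersetCard] at hS
    unfold andInd
    congr 1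
    simp only [mem_biUnion, forall_exists_index, and_imp, subset_iff, mem_filter, eq_iff_iff]
    constructor
    · intro h j hj
      exact ⟨hS.1 hj, fun i hi => h i j hj hi⟩
    · intro h i j hj hi
      exact (h hj).2 i hi
  rw [sum_congr rfl this, ← sum_filter, sum_const, nsmul_eq_mul, mul_one]
  congr 2
  ext S
  simp only [mem_filter, mem_powersetCard]
  constructor
  · rintro ⟨⟨_, h⟩, h'⟩; exact ⟨h', h⟩
  · rintro ⟨h', h⟩; exact ⟨⟨h'.trans (filter_subset _ _), h⟩, h'⟩

lemma truncIE_eq (B : κ → Finset ι) (J : Finset κ) (m : ℕ) (x : ι → Bool) :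
    truncIE B J m x = if satCount B J x = 0 then 1 else
      (-1) ^ m * ((satCount B J x - 1).choose m : ℝ) := by
  unfold truncIE
  simp only [sum_powersetCard_andInd]
  split_ifs with h
  · rw [h, sum_range_succ']
    simp
  · obtain ⟨k, hk⟩ := Nat.exists_eq_succ_of_ne_zero h
    have := @Int.alternating_sum_range_choose_eq_choose k m
    rw [hk]
    simp only [Nat.succ_eq_add_one, Nat.add_sub_cancel]
    exact_mod_cast this

lemma le_truncIE_of_even (B : κ → Finset ι) (J : Finset κ) {m : ℕ} (hm : Even m) (x : ι → Bool) :
    (if satCount B J x = 0 then 1 else 0) ≤ truncIE B J m x := by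
  rw [truncIE_eq, hm.neg_one_pow]
  split_ifs
  · exact le_rfl
  · positivity

lemma truncIE_nonneg_of_even (B : κ → Finset ι) (J : Finset κ) {m : ℕ} (hm : Even m)
    (x : ι → Bool) : 0 ≤ truncIE B J m x := by
  refine le_trans ?_ (le_truncIE_of_even B J hm x)
  split_ifs <;> norm_num

lemma truncIE_le_of_even (B : κ → Finset ι) (J : Finset κ) {m : ℕ} (hm : Even m) (x : ι → Bool) :
    truncIE B J m x ≤ (if satCount B J x = 0 then 1 else 0) + ((satCount B J x).choose m : ℝ) := by
  rw [truncIE_eq, hm.neg_one_pow]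
  split_ifs
  · exact le_add_of_nonneg_right (by positivity)
  · rw [one_mul, zero_add]
    exact_mod_cast Nat.choose_le_choose m (Nat.sub_le _ _)

lemma truncIE_le_of_odd (B : κ → Finset ι) (J : Finset κ) {m : ℕ} (hm : Odd m) (x : ι → Bool) :
    truncIE B J m x ≤ if satCount B J x = 0 then 1 else 0 := by
  rw [truncIE_eq, hm.neg_one_pow]
  split_ifs
  · exact le_rfl
  · rw [neg_one_mul, neg_nonpos]
    positivity

/-- The binomial expansion of `(1 - p) ^ k` truncated at level `m`. -/
noncomputable def truncBinom (p : ℝ) (k m : ℕ) : ℝ :=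
  ∑ i ∈ range (m + 1), (-1) ^ i * ((k.choose i : ℝ) * p ^ i)

lemma abs_truncBinom_sub_le {p : ℝ} (hp : 0 ≤ p) (k m : ℕ) :
    |truncBinom p k m - (1 - p) ^ k| ≤ (1 + 3 * p) ^ k / 3 ^ m := by
  have key : ∀ z : ℝ, (1 + z) ^ k = ∑ i ∈ range (m + 1 + k), (k.choose i : ℝ) * z ^ i := by
    intro z
    rw [add_comm 1 z, add_pow]
    have hsub : range (k + 1) ⊆ range (m + 1 + k) := range_subset_range.2 (by omega)
    rw [← sum_subset hsub]
    · exact sum_congr rfl fun i _ => by ring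
    · intro i _ hi
      rw [Nat.choose_eq_zero_of_lt (by simpa using hi)]
      simp
  have h1 := key (-p)
  have h3 := key (3 * p)
  rw [sum_range_add] at h1 h3
  have hneg : (1 - p) ^ k = truncBinom p k m +
      ∑ x ∈ range k, (k.choose (m + 1 + x) : ℝ) * (-p) ^ (m + 1 + x) := by
    rw [sub_eq_add_neg, h1]
    congr 1
    exact sum_congr rfl fun i _ => by rw [neg_pow]; ring
  rw [hneg, sub_add_cancel_left, abs_neg]
  calc |∑ x ∈ range k, (k.choose (m + 1 + x) : ℝ) * (-p) ^ (m + 1 + x)|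
      ≤ ∑ x ∈ range k, (k.choose (m + 1 + x) : ℝ) * p ^ (m + 1 + x) := by
        refine (abs_sum_le_sum_abs _ _).trans (sum_le_sum fun x _ => ?_)
        rw [abs_mul, abs_pow, abs_neg, abs_of_nonneg hp, Nat.abs_cast]
    _ ≤ ∑ x ∈ range k, (k.choose (m + 1 + x) : ℝ) * (3 * p) ^ (m + 1 + x) / 3 ^ m := by
        refine sum_le_sum fun x _ => ?_
        rw [mul_div_assoc]
        refine mul_le_mul_of_nonneg_left ?_ (by positivity)
        rw [le_div_iff₀ (by positivity), mul_pow, mul_comm]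
        refine mul_le_mul_of_nonneg_right ?_ (by positivity)
        exact pow_le_pow_right₀ (by norm_num) (by omega)
    _ = (∑ x ∈ range k, (k.choose (m + 1 + x) : ℝ) * (3 * p) ^ (m + 1 + x)) / 3 ^ m := by
        rw [sum_div]
    _ ≤ _ := by
        refine div_le_div_of_nonneg_right ?_ (by positivity)
        rw [h3]
        exact le_add_of_nonneg_left (by positivity)

lemma card_biUnion_eq_mul {ι κ : Type*} [DecidableEq ι] {B : κ → Finset ι} {J S : Finset κ} {w : ℕ}
    (hB : ∀ j ∈ J, (B j).card = w) (hdisj : (J : Set κ).PairwiseDisjoint B) (hS : S ⊆ J) :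
    (S.biUnion B).card = w * S.card := by
  classical
  rw [card_biUnion (fun x hx y hy hxy => hdisj (hS hx) (hS hy) hxy),
    sum_congr rfl (fun j hj => hB j (hS hj)), sum_const, smul_eq_mul, mul_comm]

lemma wExp_andInd_mul_truncIE {D : (ι → Bool) → ℝ} {t : ℕ} (hD : AndUniform D t)
    {B : κ → Finset ι} {J : Finset κ} {w m : ℕ} {I : Finset ι}
    (hB : ∀ j ∈ J, (B j).card = w) (hdisj : (J : Set κ).PairwiseDisjoint B)
    (hI : ∀ j ∈ J, Disjoint I (B j)) (ht : I.card + w * m ≤ t) :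
    wExp D (fun x => andInd I x * truncIE B J m x) =
      (1 / 2) ^ I.card * truncBinom ((1 / 2) ^ w) J.card m := by
  unfold truncIE truncBinom
  simp only [mul_sum, wExp_sum]
  refine sum_congr rfl fun i hi => ?_
  have : ∀ S ∈ powersetCard i J, wExp D (fun x => andInd I x * ((-1) ^ i * andInd (S.biUnion B) x))
      = (-1) ^ i * (1 / 2) ^ (I.card + w * i) := by
    intro S hS
    rw [mem_powersetCard] at hS
    have hcard : (I ∪ S.biUnion B).card = I.card + w * i := by
      rw [card_union_of_disjoint ((disjoint_biUnion_right _ _ _).2 fun j hj => hI j (hS.1 hj)),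
        card_biUnion_eq_mul hB hdisj hS.1, hS.2]
    rw [← hcard, ← hD, ← wExp_const_mul]
    · congr 1
      ext x
      rw [← andInd_mul]; ring
    · rw [hcard]
      have : w * i ≤ w * m := Nat.mul_le_mul_left _ (by simpa [Nat.lt_succ_iff] using hi)
      omega
  rw [sum_congr rfl this, sum_const, card_powersetCard, nsmul_eq_mul, pow_add, pow_mul]
  ring

lemma wExp_truncIE {D : (ι → Bool) → ℝ} {t : ℕ} (hD : AndUniform D t)
    {B : κ → Finset ι} {J : Finset κ} {w m : ℕ}
    (hB : ∀ j ∈ J, (B j).card = w) (hdisj : (J : Set κ).PairwiseDisjoint B) (ht : w * m ≤ t) :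
    wExp D (truncIE B J m) = truncBinom ((1 / 2) ^ w) J.card m := by
  have := wExp_andInd_mul_truncIE hD (I := ∅) hB hdisj (by simp) (by simpa using ht)
  simpa [andInd] using this

/-- Products of two truncated sums have the same expectation under any two distributions that
are sufficiently independent. -/
lemma wExp_truncIE_mul_truncIE_congr {D D' : (ι → Bool) → ℝ} {t : ℕ} (hD : AndUniform D t)
    (hD' : AndUniform D' t) {B : κ → Finset ι} {J J' : Finset κ} {w m : ℕ}
    (hB : ∀ j, (B j).card ≤ w) (ht : 2 * (w * m) ≤ t) :
    wExp D (fun x => truncIE B J m x * truncIE B J' m x) =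
      wExp D' (fun x => truncIE B J m x * truncIE B J' m x) := by
  have hcard : ∀ (i : ℕ) (S : Finset κ), i < m + 1 → S.card = i → (S.biUnion B).card ≤ w * m := by
    intro i S hi hS
    refine card_biUnion_le.trans ((sum_le_sum fun j _ => hB j).trans ?_)
    rw [sum_const, smul_eq_mul, hS, mul_comm]
    exact Nat.mul_le_mul_left _ (by omega)
  unfold truncIE
  simp only [mul_sum, sum_mul, wExp_sum]
  refine sum_congr rfl fun i hi => sum_congr rfl fun S hS => sum_congr rfl fun i' hi' =>
    sum_congr rfl fun S' hS' => ?_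
  rw [mem_powersetCard] at hS hS'
  rw [mem_range] at hi hi'
  have h : (S.biUnion B ∪ S'.biUnion B).card ≤ t := by
    refine (card_union_le _ _).trans ?_
    have := hcard i S hi hS.2
    have := hcard i' S' hi' hS'.2
    omega
  have e : (fun x => (-1 : ℝ) ^ i * andInd (S.biUnion B) x * ((-1) ^ i' * andInd (S'.biUnion B) x))
      = fun x => ((-1) ^ i * (-1) ^ i') * andInd (S.biUnion B ∪ S'.biUnion B) x := by
    ext x
    rw [← andInd_mul]; ring
  simp only [mul_comm, mul_left_comm] at e ⊢
  simp only [e]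
  rw [wExp_const_mul, wExp_const_mul, hD _ h, hD' _ h]

/-- Product formula for a disjoint family of conjunctions. -/
lemma wExp_prod_one_add_mul {D : (ι → Bool) → ℝ} (hD : ∀ t, AndUniform D t)
    {B : κ → Finset ι} {J : Finset κ} {w : ℕ}
    (hB : ∀ j ∈ J, (B j).card = w) (hdisj : (J : Set κ).PairwiseDisjoint B) (z : ℝ) :
    wExp D (fun x => ∏ j ∈ J, (1 + z * andInd (B j) x)) = (1 + z * (1 / 2) ^ w) ^ J.card := by
  simp only [prod_one_add, prod_mul_distrib, prod_const, prod_andInd]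
  rw [wExp_sum, add_comm 1, ← sum_pow_mul_eq_add_pow]
  refine sum_congr rfl fun S hS => ?_
  rw [wExp_const_mul, hD _ _ le_rfl, card_biUnion_eq_mul hB hdisj (mem_powerset.1 hS), pow_mul,
    one_pow, mul_one, mul_pow]

/-- A conjunction is independent of disjoint conjunctions. -/
lemma wExp_andInd_mul_prod {D : (ι → Bool) → ℝ} (hD : ∀ t, AndUniform D t)
    {B : κ → Finset ι} {K : Finset κ} {I : Finset ι} (hI : ∀ k ∈ K, Disjoint I (B k)) :
    wExp D (fun x => andInd I x * ∏ k ∈ K, (1 - andInd (B k) x)) =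
      (1 / 2) ^ I.card * wExp D (fun x => ∏ k ∈ K, (1 - andInd (B k) x)) := by
  have e : ∀ x, ∏ k ∈ K, (1 - andInd (B k) x) =
      ∑ S ∈ K.powerset, (-1) ^ S.card * andInd (S.biUnion B) x := by
    intro x
    have : ∀ k, 1 - andInd (B k) x = 1 + (-1) * andInd (B k) x := fun k => by ring
    simp only [this, prod_one_add, prod_mul_distrib, prod_const, prod_andInd]
  simp only [e, mul_sum, wExp_sum]
  refine sum_congr rfl fun S hS => ?_
  rw [mem_powerset] at hS
  simp only [mul_left_comm (andInd I _), andInd_mul, wExp_const_mul]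
  rw [hD _ _ le_rfl, hD _ _ le_rfl,
    card_union_of_disjoint ((disjoint_biUnion_right _ _ _).2 fun j hj => hI j (hS hj)), pow_add]
  ring

/-- The uniform weights on the cube. -/
noncomputable def unifWeight {ι : Type*} [Fintype ι] : (ι → Bool) → ℝ :=
  fun _ => (1 / 2) ^ Fintype.card ι

lemma unifWeight_andUniform (t : ℕ) : AndUniform (unifWeight : (ι → Bool) → ℝ) t := by
  intro I _
  have e : ∀ x : ι → Bool, unifWeight x * andInd I x =
      ∏ i, (1 / 2 * if i ∈ I then (if x i = true then 1 else 0) else 1 : ℝ) := by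
    intro x
    rw [prod_mul_distrib, prod_const, card_univ, unifWeight]
    congr 1
    rw [prod_ite, prod_const_one, mul_one, filter_mem_eq_inter, univ_inter, andInd]
    rw [prod_ite_zero, prod_const_one]
    congr
  unfold wExp
  simp only [e]
  have := prod_univ_sum (fun _ : ι => (univ : Finset Bool))
    (fun i b => (1 / 2 * if i ∈ I then (if b = true then 1 else 0) else 1 : ℝ))
  rw [Fintype.piFinset_univ] at this
  rw [← this]
  have e2 : ∀ i : ι, (∑ b : Bool, (1 / 2 * if i ∈ I then (if b = true then 1 else 0) else 1 : ℝ))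
      = if i ∈ I then 1 / 2 else 1 := by
    intro i
    by_cases h : i ∈ I <;> simp [h]
  simp only [e2]
  rw [prod_ite, prod_const_one, mul_one, filter_mem_eq_inter, univ_inter, prod_const]

lemma unifWeight_nonneg {ι : Type*} [Fintype ι] (x : ι → Bool) : 0 ≤ unifWeight x := by
  unfold unifWeight; positivity

end Expectation

section Janson

variable {ι κ : Type*} [Fintype ι] [DecidableEq ι]

lemma wExp_unifWeight_andInd (I : Finset ι) :
    wExp unifWeight (andInd I) = (1 / 2) ^ I.card := unifWeight_andUniform _ I le_rfl

lemma sum_unifWeight : ∑ x : ι → Bool, unifWeight x = (1 : ℝ) := by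
  simpa [wExp, andInd] using wExp_unifWeight_andInd (∅ : Finset ι)

/-- Harris' inequality for an antitone function and a conjunction. -/
lemma wExp_antitone_mul_andInd_le {F : (ι → Bool) → ℝ} (hF : Antitone F) (h1 : ∀ x, F x ≤ 1)
    (I : Finset ι) :
    wExp unifWeight (fun x => F x * andInd I x) ≤ wExp unifWeight F * (1 / 2) ^ I.card := by
  have := fkg (μ := (unifWeight : (ι → Bool) → ℝ)) (f := fun x => 1 - F x) (g := andInd I)
    (fun x => unifWeight_nonneg x) (fun x => sub_nonneg.2 (h1 x)) (andInd_nonneg I)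
    (fun x y hxy => sub_le_sub_left (hF hxy) 1) (andInd_mono I) (fun a b => le_rfl)
  change wExp unifWeight (fun x => 1 - F x) * wExp unifWeight (andInd I) ≤
    _ * wExp unifWeight (fun x => (1 - F x) * andInd I x) at this
  simp only [sub_mul, one_mul, wExp_sub, wExp_unifWeight_andInd, sum_unifWeight] at this
  have h : wExp (unifWeight : (ι → Bool) → ℝ) (fun _ => 1) = 1 := by
    simp [wExp, sum_unifWeight]
  rw [h] at this
  linarith

lemma one_sub_sum_le_prod_one_sub {s : Finset κ} {a : κ → ℝ} (h0 : ∀ k, 0 ≤ a k)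
    (h1 : ∀ k, a k ≤ 1) : 1 - ∑ k ∈ s, a k ≤ ∏ k ∈ s, (1 - a k) := by
  classical
  induction s using Finset.induction_on with
  | empty => simp
  | insert b s hb ih =>
    rw [sum_insert hb, prod_insert hb]
    have hp : ∏ k ∈ s, (1 - a k) ≤ 1 :=
      prod_le_one (fun k _ => sub_nonneg.2 (h1 k)) fun k _ => by linarith [h0 k]
    nlinarith [h0 b]

lemma prod_one_sub_andInd_mem (B : κ → Finset ι) (K : Finset κ) (x : ι → Bool) :
    0 ≤ ∏ k ∈ K, (1 - andInd (B k) x) ∧ ∏ k ∈ K, (1 - andInd (B k) x) ≤ 1 :=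
  ⟨prod_nonneg fun k _ => sub_nonneg.2 (andInd_le_one _ _),
    prod_le_one (fun k _ => sub_nonneg.2 (andInd_le_one _ _)) fun k _ => by
      linarith [andInd_nonneg (B k) x]⟩

lemma prod_one_sub_andInd_antitone (B : κ → Finset ι) (K : Finset κ) :
    Antitone fun x => ∏ k ∈ K, (1 - andInd (B k) x) := fun _ _ hxy =>
  prod_le_prod (fun _ _ => sub_nonneg.2 (andInd_le_one _ _))
    fun _ _ => sub_le_sub_left (andInd_mono _ hxy) 1

/-- One step of Janson's inequality. -/
lemma wExp_prod_insert_le [DecidableEq κ] (B : κ → Finset ι) {K : Finset κ} {k : κ} (hk : k ∉ K)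
    {δ : ℝ} (hδ : ∑ i ∈ K with ¬ Disjoint (B k) (B i), (1 / 2 : ℝ) ^ (B i ∪ B k).card ≤ δ)
    (hδ' : δ ≤ (1 / 2) ^ (B k).card) :
    wExp unifWeight (fun x => ∏ i ∈ insert k K, (1 - andInd (B i) x)) ≤
      (1 - (1 / 2) ^ (B k).card + δ) *
        wExp unifWeight (fun x => ∏ i ∈ K, (1 - andInd (B i) x)) := by
  set near := K.filter fun i => ¬ Disjoint (B k) (B i) with hnear
  set far := K.filter fun i => Disjoint (B k) (B i) with hfar
  set F : (ι → Bool) → ℝ := fun x => ∏ i ∈ far, (1 - andInd (B i) x) with hF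
  set W : (ι → Bool) → ℝ := fun x => ∏ i ∈ K, (1 - andInd (B i) x) with hW
  have hsplit : ∀ x, W x = F x * ∏ i ∈ near, (1 - andInd (B i) x) := fun x =>
    (prod_filter_mul_prod_filter_not K (fun i => Disjoint (B k) (B i)) _).symm
  have hWF : wExp unifWeight W ≤ wExp unifWeight F := by
    refine wExp_mono unifWeight_nonneg fun x => ?_
    rw [hsplit]
    exact mul_le_of_le_one_right (prod_one_sub_andInd_mem B far x).1
      (prod_one_sub_andInd_mem B near x).2
  have hFk : wExp unifWeight (fun x => andInd (B k) x * F x) =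
      (1 / 2) ^ (B k).card * wExp unifWeight F :=
    wExp_andInd_mul_prod unifWeight_andUniform fun i hi => (mem_filter.1 hi).2
  have hpair : ∑ i ∈ near, wExp unifWeight (fun x => F x * andInd (B i ∪ B k) x) ≤
      wExp unifWeight F * δ := by
    refine (sum_le_sum fun i _ => wExp_antitone_mul_andInd_le
      (prod_one_sub_andInd_antitone B far) (fun x => (prod_one_sub_andInd_mem B far x).2) _).trans ?_
    rw [← mul_sum]
    exact mul_le_mul_of_nonneg_left hδ
      (wExp_nonneg unifWeight_nonneg fun x => (prod_one_sub_andInd_mem B far x).1)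
  have hlow : wExp unifWeight (fun x => andInd (B k) x * F x) -
      ∑ i ∈ near, wExp unifWeight (fun x => F x * andInd (B i ∪ B k) x) ≤
      wExp unifWeight (fun x => andInd (B k) x * W x) := by
    rw [← wExp_sum, ← wExp_sub]
    refine wExp_mono unifWeight_nonneg fun x => ?_
    simp only [← andInd_mul]
    have h1 := one_sub_sum_le_prod_one_sub (s := near) (fun i => andInd_nonneg (B i) x)
      (fun i => andInd_le_one (B i) x)
    have h2 : 0 ≤ andInd (B k) x * F x :=
      mul_nonneg (andInd_nonneg _ _) (prod_one_sub_andInd_mem B far x).1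
    have h3 := mul_le_mul_of_nonneg_left h1 h2
    rw [hsplit]
    refine le_trans (le_of_eq ?_) (h3.trans (le_of_eq (by ring)))
    rw [mul_sub, mul_one, mul_sum]
    congr 1
    exact sum_congr rfl fun i _ => by ring
  have hins : wExp unifWeight (fun x => ∏ i ∈ insert k K, (1 - andInd (B i) x)) =
      wExp unifWeight W - wExp unifWeight (fun x => andInd (B k) x * W x) := by
    rw [← wExp_sub]
    congr 1
    ext x
    rw [prod_insert hk]
    ring
  rw [hins]
  have := mul_le_mul_of_nonneg_right hWF (sub_nonneg.2 hδ')
  linarith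

/-- Janson's inequality: adding `J` to the family `K` costs at most the product of the
single probabilities, up to the correction `δ`. -/
lemma wExp_prod_union_le [DecidableEq κ] (B : κ → Finset ι) {K J : Finset κ} {w : ℕ} {δ : ℝ}
    (hKJ : Disjoint K J) (hB : ∀ j ∈ J, (B j).card = w)
    (hdisj : (J : Set κ).PairwiseDisjoint B)
    (hδ : ∀ j ∈ J, ∑ i ∈ K with ¬ Disjoint (B j) (B i), (1 / 2 : ℝ) ^ (B i ∪ B j).card ≤ δ)
    (hδ' : δ ≤ (1 / 2) ^ w) (hw : (1 / 2 : ℝ) ^ w ≤ 1) (hδ0 : 0 ≤ δ) :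
    wExp unifWeight (fun x => ∏ i ∈ K ∪ J, (1 - andInd (B i) x)) ≤
      (1 - (1 / 2) ^ w + δ) ^ J.card *
        wExp unifWeight (fun x => ∏ i ∈ K, (1 - andInd (B i) x)) := by
  induction J using Finset.induction_on with
  | empty => simp
  | insert j J hj ih =>
    have ih := ih (hKJ.mono_right (subset_insert _ _)) (fun i hi => hB i (mem_insert_of_mem hi))
      (hdisj.subset (by simp)) (fun i hi => hδ i (mem_insert_of_mem hi))
    have hjK : j ∉ K ∪ J := by
      rw [mem_union, not_or]
      exact ⟨disjoint_right.1 hKJ (mem_insert_self _ _), hj⟩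
    have hnear : (K ∪ J).filter (fun i => ¬ Disjoint (B j) (B i)) =
        K.filter (fun i => ¬ Disjoint (B j) (B i)) := by
      rw [filter_union, union_eq_left]
      intro i hi
      rw [mem_filter] at hi
      exact absurd (hdisj (by simp) (by simp [hi.1]) (fun h : j = i => hj (by rw [h]; exact hi.1))) hi.2
    have hBj := hB j (mem_insert_self _ _)
    have step := wExp_prod_insert_le B hjK (δ := δ)
      (by rw [hnear]; exact hδ j (mem_insert_self _ _)) (by rw [hBj]; exact hδ')
    rw [hBj] at step
    rw [union_insert, card_insert_of_notMem hj, pow_succ']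
    refine step.trans ?_
    rw [mul_assoc]
    exact mul_le_mul_of_nonneg_left ih (by linarith)

end Janson

section Selection

lemma exp_le_one_add_two_mul {y : ℝ} (h0 : 0 ≤ y) (h1 : y ≤ 1) : Real.exp y ≤ 1 + 2 * y := by
  have := (abs_le.1 (Real.abs_exp_sub_one_sub_id_le (x := y) (by rw [abs_of_nonneg h0]; exact h1))).2
  nlinarith

/-- Greedy selection of a sequence avoiding a sparse relation `R` and with small averages of
all the test functions `fun g => Y g q`. -/
lemma exists_seq_sum_exp_le {G Θ : Type*} [Fintype G] [Fintype Θ] (Y : G → Θ → ℝ)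
    (hY0 : ∀ g q, 0 ≤ Y g q) (hY1 : ∀ g q, Y g q ≤ 1) {N : ℝ} (hN : 2 ≤ N)
    (hmean : ∀ q, ∑ g, Y g q ≤ 2 / N * Fintype.card G)
    (hG : 0 < Fintype.card G) (R : G → G → Prop) [∀ g, DecidablePred (R g)] {b u : ℕ}
    (hR : ∀ g', #{g | R g' g} ≤ b) (hb : (u * b : ℕ) * N ≤ Fintype.card G) :
    ∀ k ≤ u, ∃ ω : ℕ → G, (∀ j < k, ∀ i < j, ¬ R (ω i) (ω j)) ∧
      ∑ q, Real.exp (∑ i ∈ range k, Y (ω i) q) ≤ Fintype.card Θ * Real.exp (10 / N * k) := by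
  classical
  have hN0 : 0 < N := by linarith
  have : Nonempty G := Fintype.card_pos_iff.1 hG
  intro k
  induction k with
  | zero => intro _; exact ⟨fun _ => Classical.arbitrary G, by simp, by simp⟩
  | succ k ih =>
    intro hk
    obtain ⟨ω, hω, hsum⟩ := ih (by omega)
    set good : Finset G := {g | ∀ i < k, ¬ R (ω i) g} with hgood
    have hcompl : (goodᶜ).card ≤ u * b := by
      have hsub : goodᶜ ⊆ (range k).biUnion fun i => ({g | R (ω i) g} : Finset G) := by
        intro g hg
        simpa [hgood] using hg
      refine (card_le_card hsub).trans (card_biUnion_le.trans ((sum_le_sum fun i _ => hR _).trans ?_))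
      rw [sum_const, card_range, smul_eq_mul]
      exact Nat.mul_le_mul_right _ (by omega)
    have hcard : (1 - 1 / N) * (Fintype.card G : ℝ) ≤ good.card := by
      have h1 : (good.card : ℝ) + (goodᶜ).card = Fintype.card G := by
        exact_mod_cast card_add_card_compl good
      have h2 : ((goodᶜ).card : ℝ) ≤ (u * b : ℕ) := by exact_mod_cast hcompl
      have h3 : ((u * b : ℕ) : ℝ) ≤ Fintype.card G / N := (le_div_iff₀ hN0).2 hb
      have h4 : (1 - 1 / N) * (Fintype.card G : ℝ) = Fintype.card G - Fintype.card G / N := by ring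
      linarith
    have hGpos : (0 : ℝ) < Fintype.card G := by exact_mod_cast hG
    have hinv : 1 / N ≤ 1 / 2 := one_div_le_one_div_of_le (by norm_num) hN
    have hgood_pos : (0 : ℝ) < good.card := lt_of_lt_of_le (mul_pos (by linarith) hGpos) hcard
    have hne : good.Nonempty := card_pos.1 (by exact_mod_cast hgood_pos)
    set Φ : G → ℝ := fun g => ∑ q, Real.exp (∑ i ∈ range k, Y (ω i) q) * Real.exp (Y g q) with hΦ
    set T : ℝ := Fintype.card Θ * Real.exp (10 / N * (k + 1 : ℕ)) with hT
    have hT0 : 0 ≤ T := by positivity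
    have hsumΦ : ∑ g ∈ good, Φ g ≤ ∑ _g ∈ good, T := by
      have h1 : ∑ g ∈ good, Φ g ≤ ∑ g, Φ g :=
        sum_le_sum_of_subset_of_nonneg (subset_univ _) fun g _ _ =>
          sum_nonneg fun q _ => by positivity
      have h2 : ∑ g, Φ g ≤ (∑ q, Real.exp (∑ i ∈ range k, Y (ω i) q)) *
          ((1 + 4 / N) * Fintype.card G) := by
        rw [hΦ, sum_comm, sum_mul]
        refine sum_le_sum fun q _ => ?_
        rw [← mul_sum]
        refine mul_le_mul_of_nonneg_left ?_ (Real.exp_pos _).le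
        calc ∑ g, Real.exp (Y g q) ≤ ∑ g, (1 + 2 * Y g q) :=
              sum_le_sum fun g _ => exp_le_one_add_two_mul (hY0 g q) (hY1 g q)
          _ = Fintype.card G + 2 * ∑ g, Y g q := by
              rw [sum_add_distrib, ← mul_sum]; simp
          _ ≤ Fintype.card G + 2 * (2 / N * Fintype.card G) := by
              linarith [hmean q]
          _ = _ := by ring
      have h3 : (1 + 4 / N) ≤ (1 - 1 / N) * Real.exp (10 / N) := by
        have he : 10 / N + 1 ≤ Real.exp (10 / N) := Real.add_one_le_exp _
        have hx : 0 < 1 / N := by positivity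
        have e1 : 10 / N = 10 * (1 / N) := by ring
        have e2 : 4 / N = 4 * (1 / N) := by ring
        rw [e1] at he ⊢
        rw [e2]
        nlinarith
      calc ∑ g ∈ good, Φ g ≤ _ := h1.trans h2
        _ ≤ (Fintype.card Θ * Real.exp (10 / N * k)) *
            (((1 - 1 / N) * Real.exp (10 / N)) * Fintype.card G) := by
          refine mul_le_mul hsum ?_ (by positivity) (by positivity)
          exact mul_le_mul_of_nonneg_right h3 hGpos.le
        _ = ((1 - 1 / N) * Fintype.card G) * T := by
          rw [hT, Nat.cast_add, Nat.cast_one, mul_add, mul_one, Real.exp_add]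
          ring
        _ ≤ good.card * T := mul_le_mul_of_nonneg_right hcard hT0
        _ = _ := by rw [sum_const, nsmul_eq_mul]
    obtain ⟨g, hg, hgT⟩ := exists_le_of_sum_le hne hsumΦ
    have hlt : ∀ i, i < k → Function.update ω k g i = ω i := fun i hi =>
      Function.update_of_ne (by omega) _ _
    refine ⟨Function.update ω k g, ?_, ?_⟩
    · intro j hj i hij
      rw [hlt i (by omega)]
      rcases (by omega : j < k ∨ j = k) with h | h
      · rw [hlt j h]
        exact hω j h i hij
      · rw [h, Function.update_self]
        exact (mem_filter.1 hg).2 i (by omega)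
    · refine le_trans (le_of_eq ?_) hgT
      refine sum_congr rfl fun q _ => ?_
      rw [sum_range_succ, Function.update_self, Real.exp_add]
      congr 2
      exact sum_congr rfl fun i hi => by rw [hlt i (mem_range.1 hi)]

lemma exists_seq_sum_le {G Θ : Type*} [Fintype G] [Fintype Θ] [Nonempty Θ] (Y : G → Θ → ℝ)
    (hY0 : ∀ g q, 0 ≤ Y g q) (hY1 : ∀ g q, Y g q ≤ 1) {N : ℝ} (hN : 2 ≤ N)
    (hmean : ∀ q, ∑ g, Y g q ≤ 2 / N * Fintype.card G)
    (hG : 0 < Fintype.card G) (R : G → G → Prop) [∀ g, DecidablePred (R g)] {b u : ℕ}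
    (hR : ∀ g', #{g | R g' g} ≤ b) (hb : (u * b : ℕ) * N ≤ Fintype.card G) :
    ∃ ω : ℕ → G, (∀ j < u, ∀ i < j, ¬ R (ω i) (ω j)) ∧
      ∀ q, ∑ i ∈ range u, Y (ω i) q ≤ Real.log (Fintype.card Θ) + 10 / N * u := by
  obtain ⟨ω, h1, h2⟩ := exists_seq_sum_exp_le Y hY0 hY1 hN hmean hG R hR hb u le_rfl
  refine ⟨ω, h1, fun q => ?_⟩
  have h3 : Real.exp (∑ i ∈ range u, Y (ω i) q) ≤ Fintype.card Θ * Real.exp (10 / N * u) :=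
    (single_le_sum (f := fun q => Real.exp (∑ i ∈ range u, Y (ω i) q))
      (fun q _ => (Real.exp_pos _).le) (mem_univ q)).trans h2
  have hΘ : (0 : ℝ) < Fintype.card Θ := by exact_mod_cast Fintype.card_pos
  rw [← Real.exp_log hΘ, ← Real.exp_add, Real.exp_le_exp] at h3
  exact h3

end Selection

section Blocks

variable {w : ℕ} {V β : Type*} [AddCommGroup V] [Fintype V] [DecidableEq V] [DecidableEq β]

/-- The `j`-th vertical translate of the graph of `g`, embedded through `e`. -/
def graphBlock (e : Fin w × V ↪ β) (g : Fin w → V) (j : V) : Finset β :=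
  univ.image fun a => e (a, g a + j)

omit [Fintype V] [DecidableEq V] in
lemma card_graphBlock (e : Fin w × V ↪ β) (g : Fin w → V) (j : V) :
    (graphBlock e g j).card = w := by
  unfold graphBlock
  rw [card_image_of_injective, card_univ, Fintype.card_fin]
  intro a b h
  exact (Prod.ext_iff.1 (e.injective h)).1

omit [Fintype V] [DecidableEq V] in
lemma graphBlock_disjoint (e : Fin w × V ↪ β) (g : Fin w → V) {j k : V} (hjk : j ≠ k) :
    Disjoint (graphBlock e g j) (graphBlock e g k) := by
  rw [disjoint_left]
  intro x hx hy
  simp only [graphBlock, mem_image, mem_univ, true_and] at hx hy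
  obtain ⟨a, rfl⟩ := hx
  obtain ⟨b, hb⟩ := hy
  have := Prod.ext_iff.1 (e.injective hb)
  obtain ⟨h1, h2⟩ := this
  simp only at h1 h2
  subst h1
  exact hjk (add_left_cancel h2).symm

omit [Fintype V] in
lemma card_graphBlock_inter_le (e : Fin w × V ↪ β) (g g' : Fin w → V) (j k : V) :
    (graphBlock e g j ∩ graphBlock e g' k).card ≤ #{a | g a - g' a = k - j} := by
  have : graphBlock e g j ∩ graphBlock e g' k ⊆
      ({a | g a - g' a = k - j} : Finset (Fin w)).image fun a => e (a, g a + j) := by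
    intro x hx
    simp only [graphBlock, mem_inter, mem_image, mem_univ, true_and] at hx
    obtain ⟨⟨a, rfl⟩, b, hb⟩ := hx
    obtain ⟨h1, h2⟩ := Prod.ext_iff.1 (e.injective hb)
    simp only at h1 h2
    subst h1
    refine mem_image.2 ⟨b, ?_, rfl⟩
    rw [mem_filter]
    refine ⟨mem_univ _, ?_⟩
    rw [sub_eq_sub_iff_add_eq_add, ← h2]
    abel
  exact (card_le_card this).trans card_image_le

omit [Fintype V] [DecidableEq V] in
lemma card_graphBlock_inter (e : Fin w × V ↪ β) (g : Fin w → V) (j : V) (Q : Finset β) :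
    (graphBlock e g j ∩ Q).card = #{a | e (a, g a + j) ∈ Q} := by
  unfold graphBlock
  rw [← filter_mem_eq_inter, filter_image, card_image_of_injective]
  intro a b h
  exact (Prod.ext_iff.1 (e.injective h)).1

omit [DecidableEq V] in
lemma sum_prod_translate (f : Fin w → V → ℝ) (j : V) :
    ∑ g : Fin w → V, ∏ a, f a (g a + j) = ∏ a, ∑ b, f a b := by
  rw [prod_univ_sum, Fintype.piFinset_univ]
  exact Equiv.sum_comp (Equiv.addRight (fun _ : Fin w => j))
    fun g : Fin w → V => ∏ a, f a (g a)

lemma prod_ite_card {s : Type*} [Fintype s] (p : s → Prop) [DecidablePred p] (c : ℝ) :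
    ∏ a, (if p a then c else 1) = c ^ #{a | p a} := by
  rw [prod_ite, prod_const, prod_const_one, mul_one]

/-- Few functions agree with a translate of `g'` in more than `h` places. -/
lemma card_filter_agree_mul_le (g' : Fin w → V) (h : ℕ) :
    #{g : Fin w → V | ∃ d, h < #{a | g a - g' a = d}} * Fintype.card V ^ (h + 1) ≤
      Fintype.card V * (2 * Fintype.card V) ^ w := by
  set v := Fintype.card V
  have hv : 1 ≤ v := Fintype.card_pos
  have key : (#{g : Fin w → V | ∃ d, h < #{a | g a - g' a = d}} * v ^ (h + 1) : ℝ) ≤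
      ∑ g : Fin w → V, ∑ d, ∏ a, (if g a - g' a = d then (v : ℝ) else 1) := by
    rw [← nsmul_eq_mul, ← sum_const]
    refine (sum_le_sum fun g hg => ?_).trans (sum_le_sum_of_subset_of_nonneg (subset_univ _) ?_)
    · obtain ⟨d, hd⟩ := (mem_filter.1 hg).2
      refine le_trans ?_ (single_le_sum
        (f := fun d => ∏ a, (if g a - g' a = d then (v : ℝ) else 1)) ?_ (mem_univ d))
      · rw [prod_ite_card]
        exact pow_le_pow_right₀ (by exact_mod_cast hv) hd
      · intro d _
        exact prod_nonneg fun a _ => by split_ifs <;> positivity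
    · intro g _ _
      exact sum_nonneg fun d _ => prod_nonneg fun a _ => by split_ifs <;> positivity
  have hd : ∀ d : V, ∑ g : Fin w → V, ∏ a, (if g a - g' a = d then (v : ℝ) else 1) ≤
      (2 * v) ^ w := by
    intro d
    have := sum_prod_translate (fun a b => if b - g' a = d then (v : ℝ) else 1) (0 : V)
    simp only [add_zero] at this
    rw [this]
    have hb : ∀ a, ∑ b, (if b - g' a = d then (v : ℝ) else 1) ≤ 2 * v := by
      intro a
      calc ∑ b, (if b - g' a = d then (v : ℝ) else 1) ≤
            ∑ b, ((if b = d + g' a then (v : ℝ) else 0) + 1) := by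
            refine sum_le_sum fun b _ => ?_
            simp only [sub_eq_iff_eq_add]
            split_ifs <;> simp
        _ = 2 * v := by
            rw [sum_add_distrib, sum_ite_eq' univ]
            simp [v]
            ring
    refine (prod_le_prod (fun a _ => sum_nonneg fun b _ => by split_ifs <;> positivity)
      fun a _ => hb a).trans (le_of_eq ?_)
    rw [prod_const, card_univ, Fintype.card_fin]
  rw [sum_comm] at key
  have := key.trans (sum_le_sum fun d _ => hd d)
  rw [sum_const, card_univ, nsmul_eq_mul] at this
  exact_mod_cast this

/-- The excess of the exponential intersection statistic of `Q` with the blocks of `g`. -/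
noncomputable def excess (e : Fin w × V ↪ β) (g : Fin w → V) (Q : Finset β) : ℝ :=
  ∑ j, ((2 : ℝ) ^ (graphBlock e g j ∩ Q).card - 1)

omit [DecidableEq V] in
lemma excess_nonneg (e : Fin w × V ↪ β) (g : Fin w → V) (Q : Finset β) : 0 ≤ excess e g Q :=
  sum_nonneg fun _ _ => sub_nonneg.2 (one_le_pow₀ (by norm_num))

omit [DecidableEq V] in
lemma sum_card_graphBlock_inter_le (e : Fin w × V ↪ β) (g : Fin w → V) (Q : Finset β) :
    ∑ j, (graphBlock e g j ∩ Q).card ≤ Q.card := by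
  rw [← card_biUnion]
  · exact card_le_card (biUnion_subset.2 fun j _ => inter_subset_right)
  · intro j _ k _ hjk
    exact (graphBlock_disjoint e g hjk).mono inter_subset_left inter_subset_left

omit [DecidableEq V] in
lemma excess_le (e : Fin w × V ↪ β) (g : Fin w → V) (Q : Finset β) :
    excess e g Q ≤ Q.card * 2 ^ w := by
  have h : ∀ j, (2 : ℝ) ^ (graphBlock e g j ∩ Q).card - 1 ≤
      (graphBlock e g j ∩ Q).card * 2 ^ w := by
    intro j
    have hw : (graphBlock e g j ∩ Q).card ≤ w :=
      (card_le_card inter_subset_left).trans (card_graphBlock e g j).le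
    rcases Nat.eq_zero_or_pos (graphBlock e g j ∩ Q).card with h0 | h0
    · simp [h0]
    · have h1 : (2 : ℝ) ^ (graphBlock e g j ∩ Q).card ≤ 2 ^ w :=
        pow_le_pow_right₀ (by norm_num) hw
      have h2 : (1 : ℝ) ≤ (graphBlock e g j ∩ Q).card := by exact_mod_cast h0
      have h3 : (0 : ℝ) ≤ 2 ^ w := by positivity
      nlinarith
  refine (sum_le_sum fun j _ => h j).trans ?_
  rw [← sum_mul]
  refine mul_le_mul_of_nonneg_right ?_ (by positivity)
  exact_mod_cast sum_card_graphBlock_inter_le e g Q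

omit [DecidableEq V] in
lemma sum_excess_le (e : Fin w × V ↪ β) {Q : Finset β} (hQ : Q.card ≤ Fintype.card V) :
    ∑ g, excess e g Q ≤ 2 * Q.card * Fintype.card (Fin w → V) := by
  set v := Fintype.card V with hvdef
  have hv : (0 : ℝ) < v := by exact_mod_cast (Fintype.card_pos : 0 < Fintype.card V)
  have hj : ∀ j : V, ∑ g : Fin w → V, (2 : ℝ) ^ (graphBlock e g j ∩ Q).card ≤
      v ^ w * (1 + 2 * (Q.card / v)) := by
    intro j
    have h1 : ∀ g : Fin w → V, (2 : ℝ) ^ (graphBlock e g j ∩ Q).card =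
        ∏ a, (if e (a, g a + j) ∈ Q then 2 else 1) := by
      intro g
      rw [prod_ite_card, card_graphBlock_inter]
    simp only [h1]
    rw [sum_prod_translate (fun a b => if e (a, b) ∈ Q then (2 : ℝ) else 1)]
    have h2 : ∀ a, ∑ b, (if e (a, b) ∈ Q then (2 : ℝ) else 1) =
        v * (1 + (#{b | e (a, b) ∈ Q} : ℝ) / v) := by
      intro a
      have : ∀ b, (if e (a, b) ∈ Q then (2 : ℝ) else 1) = 1 + if e (a, b) ∈ Q then 1 else 0 := by
        intro b; split_ifs <;> norm_num
      simp only [this, sum_add_distrib]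
      rw [mul_add, mul_div_cancel₀ _ hv.ne']
      simp [v]
    simp only [h2]
    rw [prod_mul_distrib, prod_const, card_univ, Fintype.card_fin]
    refine mul_le_mul_of_nonneg_left ?_ (by positivity)
    refine (Real.prod_one_add_le_exp_sum _ fun a => by positivity).trans ?_
    have h3 : ∑ a, #{b | e (a, b) ∈ Q} ≤ Q.card := by
      simp only [card_filter]
      rw [← Fintype.sum_prod_type' (fun a b => if e (a, b) ∈ Q then 1 else 0), ← card_filter]
      exact card_le_card_of_injOn e (fun p hp => (mem_filter.1 hp).2) e.injective.injOn
    have h4 : ∑ a, (#{b | e (a, b) ∈ Q} : ℝ) / v ≤ Q.card / v := by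
      rw [← sum_div]
      exact div_le_div_of_nonneg_right (by exact_mod_cast h3) hv.le
    refine (Real.exp_le_exp.2 h4).trans (exp_le_one_add_two_mul (by positivity) ?_)
    rw [div_le_one hv]
    exact_mod_cast hQ
  unfold excess
  rw [sum_comm]
  calc ∑ j : V, ∑ g : Fin w → V, ((2 : ℝ) ^ (graphBlock e g j ∩ Q).card - 1)
      ≤ ∑ j : V, (v ^ w * (1 + 2 * (Q.card / v)) - v ^ w : ℝ) := by
        refine sum_le_sum fun j _ => ?_
        rw [sum_sub_distrib]
        refine (sub_le_sub_right (hj j) _).trans (le_of_eq ?_)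
        simp [v]
    _ = 2 * Q.card * Fintype.card (Fin w → V) := by
        rw [sum_const, card_univ, nsmul_eq_mul, ← hvdef]
        simp only [Fintype.card_fun, Fintype.card_fin, Nat.cast_pow]
        rw [← hvdef]
        field_simp
        ring

end Blocks

section Numeric

lemma one_ninth_le_pow {w : ℕ} (hw : 1 ≤ w) : (1 / 9 : ℝ) ≤ (1 - (1 / 2) ^ w) ^ 2 ^ w := by
  have hN : (2 : ℝ) ≤ 2 ^ w := by
    simpa using pow_le_pow_right₀ (by norm_num : (1 : ℝ) ≤ 2) hw
  have hp : ((1 / 2 : ℝ)) ^ w = 1 / 2 ^ w := by rw [div_pow, one_pow]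
  have hbase : Real.exp (-(2 / 2 ^ w)) ≤ 1 - (1 / 2 : ℝ) ^ w := by
    rw [hp, Real.exp_neg, inv_le_comm₀ (Real.exp_pos _)]
    · refine le_trans ?_ (Real.add_one_le_exp _)
      rw [inv_le_iff_one_le_mul₀]
      · have h0 : (0 : ℝ) < 1 / 2 ^ w := by positivity
        have h1 : (1 : ℝ) / 2 ^ w ≤ 1 / 2 := one_div_le_one_div_of_le (by norm_num) hN
        have h2 : (2 : ℝ) / 2 ^ w = 2 * (1 / 2 ^ w) := by ring
        rw [h2]
        nlinarith
      · have h1 : (1 : ℝ) / 2 ^ w ≤ 1 / 2 := one_div_le_one_div_of_le (by norm_num) hN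
        linarith
    · have h1 : (1 : ℝ) / 2 ^ w ≤ 1 / 2 := one_div_le_one_div_of_le (by norm_num) hN
      linarith
  refine le_trans ?_ (pow_le_pow_left₀ (Real.exp_pos _).le hbase _)
  rw [← Real.exp_nat_mul]
  have : ((2 ^ w : ℕ) : ℝ) * -(2 / 2 ^ w) = -2 := by
    push_cast
    field_simp
  rw [this, Real.exp_neg, one_div]
  refine inv_anti₀ (Real.exp_pos _) ?_
  have h3 : Real.exp 1 ≤ 3 := by linarith [Real.exp_one_lt_d9]
  have : Real.exp 2 = Real.exp 1 * Real.exp 1 := by rw [← Real.exp_add]; norm_num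
  rw [this]
  nlinarith [Real.exp_pos 1]

lemma half_pow_le_half {w : ℕ} (hw : 1 ≤ w) : (1 / 2 : ℝ) ^ w ≤ 1 / 2 := by
  simpa using pow_le_pow_of_le_one (by norm_num : (0 : ℝ) ≤ 1 / 2) (by norm_num) hw

lemma pow_sub_le_nine_mul {w v q : ℕ} (hw : 1 ≤ w) (hq : q ≤ 2 ^ w) {k : ℕ} (hk : v ≤ k + q) :
    (1 - (1 / 2 : ℝ) ^ w) ^ k ≤ 9 * (1 - (1 / 2 : ℝ) ^ w) ^ v := by
  set x := 1 - (1 / 2 : ℝ) ^ w with hx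
  have h0 : 0 ≤ x := by linarith [half_pow_le_half hw]
  have h1 : x ≤ 1 := by
    have : (0 : ℝ) ≤ (1 / 2) ^ w := by positivity
    linarith
  have h2 : x ^ (k + q) ≤ x ^ v := pow_le_pow_of_le_one h0 h1 hk
  have h3 : 1 / 9 ≤ x ^ q := (one_ninth_le_pow hw).trans (pow_le_pow_of_le_one h0 h1 hq)
  rw [pow_add] at h2
  nlinarith [pow_nonneg h0 k]

lemma exp_natCast_le_three_pow (k : ℕ) : Real.exp k ≤ 3 ^ k := by
  have : Real.exp k = Real.exp 1 ^ k := by rw [← Real.exp_nat_mul, mul_one]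
  rw [this]
  exact pow_le_pow_left₀ (Real.exp_pos _).le (by linarith [Real.exp_one_lt_d9]) _

lemma one_add_mul_half_pow_le (z : ℕ) {w k L : ℕ} (hk : k ≤ 2 ^ w * L) :
    (1 + z * (1 / 2 : ℝ) ^ w) ^ k ≤ 3 ^ (z * L) := by
  refine le_trans ?_ (exp_natCast_le_three_pow _)
  have h1 : 1 + z * (1 / 2 : ℝ) ^ w ≤ Real.exp (z * (1 / 2 : ℝ) ^ w) := by
    rw [add_comm]; exact Real.add_one_le_exp _
  refine (pow_le_pow_left₀ (by positivity) h1 _).trans ?_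
  rw [← Real.exp_nat_mul, Real.exp_le_exp]
  have h2 : (k : ℝ) ≤ 2 ^ w * L := by exact_mod_cast hk
  calc (k : ℝ) * (z * (1 / 2) ^ w) ≤ 2 ^ w * L * (z * (1 / 2) ^ w) :=
        mul_le_mul_of_nonneg_right h2 (by positivity)
    _ = ((z * L : ℕ) : ℝ) * (2 * (1 / 2)) ^ w := by rw [mul_pow]; push_cast; ring
    _ = _ := by norm_num

lemma nine_pow_inv_le {w L : ℕ} (hw : 1 ≤ w) :
    ((1 / 9 : ℝ)) ^ L ≤ (1 - (1 / 2 : ℝ) ^ w) ^ (2 ^ w * L) := by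
  rw [pow_mul]
  exact pow_le_pow_left₀ (by norm_num) (one_ninth_le_pow hw) _

lemma one_sub_half_pow_le_exp {w L : ℕ} (hw : 1 ≤ w) :
    (1 - (1 / 2 : ℝ) ^ w) ^ (2 ^ w * L) ≤ Real.exp (-L) := by
  have h1 : 1 - (1 / 2 : ℝ) ^ w ≤ Real.exp (-(1 / 2 : ℝ) ^ w) := by
    linarith [Real.add_one_le_exp (-(1 / 2 : ℝ) ^ w)]
  refine (pow_le_pow_left₀ (by linarith [half_pow_le_half hw]) h1 _).trans ?_
  rw [← Real.exp_nat_mul, Real.exp_le_exp]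
  refine le_of_eq ?_
  have : (2 : ℝ) ^ w * (1 / 2) ^ w = 1 := by rw [← mul_pow]; norm_num
  push_cast
  linear_combination (-(L : ℝ)) * this

lemma truncBinom_error {w L k m : ℕ} (hk : k ≤ 2 ^ w * L) (hm : 10 * L ≤ m) :
    |truncBinom ((1 / 2) ^ w) k m - (1 - (1 / 2) ^ w) ^ k| ≤ (1 / 3 : ℝ) ^ (7 * L) := by
  refine (abs_truncBinom_sub_le (by positivity) k m).trans ?_
  have h := one_add_mul_half_pow_le 3 hk
  push_cast at h
  rw [div_le_iff₀ (by positivity)]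
  refine h.trans ?_
  calc (3 : ℝ) ^ (3 * L) = (1 / 3) ^ (7 * L) * 3 ^ (10 * L) := by
        rw [show 10 * L = 7 * L + 3 * L by ring, pow_add, ← mul_assoc, ← mul_pow]; norm_num
    _ ≤ _ := mul_le_mul_of_nonneg_left (pow_le_pow_right₀ (by norm_num) hm) (by positivity)

lemma third_pow_le {w L : ℕ} (hw : 1 ≤ w) :
    (1 / 3 : ℝ) ^ (7 * L) ≤ (1 / 3) ^ (5 * L) * (1 - (1 / 2 : ℝ) ^ w) ^ (2 ^ w * L) := by
  rw [show 7 * L = 5 * L + 2 * L by ring, pow_add]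
  refine mul_le_mul_of_nonneg_left ((le_of_eq ?_).trans (nine_pow_inv_le hw)) (by positivity)
  rw [pow_mul]; norm_num

end Numeric

section Influence

variable {β V : Type*} [Fintype β] [DecidableEq β] [Fintype V]

/-- The set `B`, seen outside `Q`. -/
def outside (Q B : Finset β) : Finset {i : β // i ∉ Q} := B.subtype (· ∉ Q)

omit [Fintype β] in
lemma card_outside_add (Q B : Finset β) : (outside Q B).card + (B ∩ Q).card = B.card := by
  unfold outside
  rw [card_subtype, filter_notMem_eq_sdiff, card_sdiff_add_card_inter]

omit [Fintype β] in
lemma outside_disjoint (Q : Finset β) {B C : Finset β} (h : Disjoint B C) :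
    Disjoint (outside Q B) (outside Q C) := by
  rw [disjoint_left] at h ⊢
  intro x hx hy
  exact h (mem_subtype.1 hx) (mem_subtype.1 hy)

/-- The probability that the disjunction over a family of disjoint blocks is undetermined outside
`Q` is bounded through the intersection statistic of `Q`. -/
lemma dPr_block_undetermined_le {Q : Finset β} {D : ({i : β // i ∉ Q} → Bool) → ℝ}
    (hD0 : ∀ x, 0 ≤ D x) {t w L : ℕ} (hD : AndUniform D t) (hw : 1 ≤ w) (hL : Even L)
    (hcardV : Fintype.card V = 2 ^ w * L) (ht : w + w * (10 * L) ≤ t)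
    {B : V → Finset β} (hB : ∀ j, (B j).card = w) (hdisj : Pairwise fun j k => Disjoint (B j) (B k))
    (hQ : Q.card ≤ 2 ^ w) :
    dPr D (fun x => (∃ j, ¬ Disjoint (B j) Q ∧ ∀ i ∈ outside Q (B j), x i = true) ∧
        ∀ j, Disjoint (B j) Q → ¬ ∀ i ∈ outside Q (B j), x i = true) ≤
      20 * (1 / 2) ^ w * (1 - (1 / 2 : ℝ) ^ w) ^ (2 ^ w * L) *
        ∑ j, ((2 : ℝ) ^ (B j ∩ Q).card - 1) := by
  classical
  set θ := (1 - (1 / 2 : ℝ) ^ w) ^ (2 ^ w * L) with hθ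
  set J : Finset V := {j | Disjoint (B j) Q} with hJ
  set M : Finset V := {j | ¬ Disjoint (B j) Q} with hM
  set C : V → Finset {i : β // i ∉ Q} := fun j => outside Q (B j) with hC
  have hm : Even (10 * L) := hL.mul_left _
  have hM_card : M.card ≤ Q.card := by
    calc M.card = ∑ _j ∈ M, 1 := by simp
      _ ≤ ∑ j ∈ M, (B j ∩ Q).card := by
          refine sum_le_sum fun j hj => ?_
          have := (mem_filter.1 hj).2
          rw [not_disjoint_iff_nonempty_inter] at this
          exact card_pos.2 this
      _ = (M.biUnion fun j => B j ∩ Q).card := (card_biUnion fun j _ k _ hjk =>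
          (hdisj hjk).mono inter_subset_left inter_subset_left).symm
      _ ≤ Q.card := card_le_card (biUnion_subset.2 fun _ _ => inter_subset_right)
  have hJM : J.card + M.card = 2 ^ w * L := by
    rw [hJ, hM, card_filter_add_card_filter_not, card_univ, hcardV]
  have hθ0 : 0 ≤ θ := pow_nonneg (by linarith [half_pow_le_half hw]) _
  have htrunc : truncBinom ((1 / 2) ^ w) J.card (10 * L) ≤ 10 * θ := by
    have h1 := (abs_le.1 (truncBinom_error (w := w) (L := L) (k := J.card) (by omega) le_rfl)).2
    have h2 := pow_sub_le_nine_mul (v := 2 ^ w * L) hw hQ (k := J.card) (by omega)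
    have h3 := third_pow_le (L := L) hw
    have h4 : (1 / 3 : ℝ) ^ (5 * L) ≤ 1 := pow_le_one₀ (by norm_num) (by norm_num)
    have h5 := mul_le_of_le_one_left hθ0 h4
    linarith
  have hCcard : ∀ j ∈ J, (C j).card = w := by
    intro j hj
    have := card_outside_add Q (B j)
    rw [disjoint_iff_inter_eq_empty.1 (mem_filter.1 hj).2, hB] at this
    simpa using this
  have hCdisj : ∀ j k, j ≠ k → Disjoint (C j) (C k) := fun j k hjk => outside_disjoint Q (hdisj hjk)
  have hterm : ∀ j ∈ M, wExp D (fun x => andInd (C j) x * truncIE C J (10 * L) x) ≤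
      20 * (1 / 2) ^ w * θ * ((2 : ℝ) ^ (B j ∩ Q).card - 1) := by
    intro j hj
    have hadd := card_outside_add Q (B j)
    rw [hB] at hadd
    rw [wExp_andInd_mul_truncIE hD hCcard (fun a _ b _ hab => hCdisj a b hab)]
    · have h1 : (1 / 2 : ℝ) ^ (C j).card = (1 / 2) ^ w * 2 ^ (B j ∩ Q).card := by
        rw [← hadd, pow_add, mul_assoc, ← mul_pow]; norm_num [hC]
      have h2 : 1 ≤ (B j ∩ Q).card := by
        have := (mem_filter.1 hj).2
        rw [not_disjoint_iff_nonempty_inter] at this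
        exact card_pos.2 this
      have h3 : (2 : ℝ) ≤ 2 ^ (B j ∩ Q).card := by
        simpa using pow_le_pow_right₀ (by norm_num : (1 : ℝ) ≤ 2) h2
      have h4 : (2 : ℝ) ^ (B j ∩ Q).card ≤ 2 * ((2 : ℝ) ^ (B j ∩ Q).card - 1) := by linarith
      rw [h1]
      calc (1 / 2 : ℝ) ^ w * 2 ^ (B j ∩ Q).card * truncBinom ((1 / 2) ^ w) J.card (10 * L)
          ≤ (1 / 2 : ℝ) ^ w * 2 ^ (B j ∩ Q).card * (10 * θ) :=
            mul_le_mul_of_nonneg_left htrunc (by positivity)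
        _ = (1 / 2 : ℝ) ^ w * (10 * θ) * 2 ^ (B j ∩ Q).card := by ring
        _ ≤ (1 / 2 : ℝ) ^ w * (10 * θ) * (2 * ((2 : ℝ) ^ (B j ∩ Q).card - 1)) :=
            mul_le_mul_of_nonneg_left h4 (by positivity)
        _ = _ := by ring
    · intro k hk
      refine hCdisj j k fun h => (mem_filter.1 hj).2 ?_
      rw [h]
      exact (mem_filter.1 hk).2
    · have : (C j).card ≤ w := by simp only [hC]; omega
      omega
  calc dPr D _ ≤ wExp D (fun x => ∑ j ∈ M, andInd (C j) x * truncIE C J (10 * L) x) := by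
        rw [dPr_eq_wExp]
        refine wExp_mono hD0 fun x => ?_
        have hnn : ∀ j ∈ M, 0 ≤ andInd (C j) x * truncIE C J (10 * L) x := fun j _ =>
          mul_nonneg (andInd_nonneg _ _) (truncIE_nonneg_of_even C J hm x)
        split_ifs with h
        · obtain ⟨⟨j, hj, hjx⟩, hall⟩ := h
          have hjM : j ∈ M := by simp [hM, hj]
          refine le_trans ?_ (single_le_sum hnn hjM)
          have h1 : andInd (C j) x = 1 := if_pos hjx
          have h2 := le_truncIE_of_even C J hm x
          have h3 : satCount C J x = 0 := by
            unfold satCount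
            rw [card_eq_zero, filter_eq_empty_iff]
            exact fun k hk => hall k (mem_filter.1 hk).2
          rw [if_pos h3] at h2
          rw [h1, one_mul]
          exact h2
        · exact sum_nonneg hnn
    _ = ∑ j ∈ M, wExp D (fun x => andInd (C j) x * truncIE C J (10 * L) x) := wExp_sum _ _ _
    _ ≤ ∑ j ∈ M, 20 * (1 / 2) ^ w * θ * ((2 : ℝ) ^ (B j ∩ Q).card - 1) := sum_le_sum hterm
    _ ≤ ∑ j, 20 * (1 / 2) ^ w * θ * ((2 : ℝ) ^ (B j ∩ Q).card - 1) :=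
        sum_le_sum_of_subset_of_nonneg (subset_univ _) fun j _ _ =>
          mul_nonneg (by positivity) (sub_nonneg.2 (one_le_pow₀ (by norm_num)))
    _ = _ := by rw [mul_sum]

end Influence

section Bias

variable {β κ : Type*} [Fintype β] [DecidableEq β]

/-- Indicator that no set of the subfamily `J` is satisfied. -/
noncomputable def zeroInd (B : κ → Finset β) (J : Finset κ) (x : β → Bool) : ℝ :=
  if satCount B J x = 0 then 1 else 0

lemma zeroInd_mem (B : κ → Finset β) (J : Finset κ) (x : β → Bool) :
    0 ≤ zeroInd B J x ∧ zeroInd B J x ≤ 1 := by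
  unfold zeroInd; split_ifs <;> norm_num

lemma prod_one_add_mul_andInd (B : κ → Finset β) (J : Finset κ) (z : ℝ) (x : β → Bool) :
    ∏ j ∈ J, (1 + z * andInd (B j) x) = (1 + z) ^ satCount B J x := by
  have : ∀ j, 1 + z * andInd (B j) x = if ∀ i ∈ B j, x i = true then 1 + z else 1 := by
    intro j; unfold andInd; split_ifs <;> simp
  simp only [this]
  rw [prod_ite, prod_const, prod_const_one, mul_one]
  rfl

lemma zeroInd_eq_prod (B : κ → Finset β) (J : Finset κ) (x : β → Bool) :
    zeroInd B J x = ∏ j ∈ J, (1 - andInd (B j) x) := by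
  have := prod_one_add_mul_andInd B J (-1) x
  simp only [neg_mul, one_mul, ← sub_eq_add_neg, sub_self] at this
  rw [this, zeroInd, zero_pow_eq]

lemma choose_mul_three_pow_le (k m : ℕ) : k.choose m * 3 ^ m ≤ 4 ^ k := by
  rw [show 4 = 3 + 1 by rfl, add_pow]
  rcases le_or_gt m k with h | h
  · have := single_le_sum (f := fun i => 3 ^ i * 1 ^ (k - i) * k.choose i)
      (fun i _ => Nat.zero_le _) (mem_range.2 (Nat.lt_succ_of_le h))
    refine le_trans (le_of_eq ?_) this
    simp [mul_comm]
  · rw [Nat.choose_eq_zero_of_lt h]; simp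

lemma choose_sq_le (B : κ → Finset β) (J : Finset κ) (m : ℕ) (x : β → Bool) :
    ((satCount B J x).choose m : ℝ) ^ 2 ≤
      (1 / 9) ^ m * ∏ j ∈ J, (1 + 15 * andInd (B j) x) := by
  rw [prod_one_add_mul_andInd]
  have h : ((satCount B J x).choose m : ℝ) * 3 ^ m ≤ 4 ^ satCount B J x := by
    exact_mod_cast choose_mul_three_pow_le _ _
  have h2 := pow_le_pow_left₀ (by positivity) h 2
  have e1 : (((satCount B J x).choose m : ℝ) * 3 ^ m) ^ 2 =
      ((satCount B J x).choose m : ℝ) ^ 2 * 9 ^ m := by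
    rw [mul_pow, ← pow_mul, mul_comm m 2, pow_mul]; norm_num
  have e2 : ((4 : ℝ) ^ satCount B J x) ^ 2 = (1 + 15) ^ satCount B J x := by
    rw [← pow_mul, mul_comm _ 2, pow_mul]; norm_num
  rw [e1, e2] at h2
  rw [div_pow, one_pow, one_div_mul_eq_div, le_div_iff₀ (by positivity)]
  exact h2

variable {B : κ → Finset β} {J : Finset κ} {w L t : ℕ} {D : (β → Bool) → ℝ}

lemma wExp_choose_sq_le (hB : ∀ j ∈ J, (B j).card = w) (hdisj : (J : Set κ).PairwiseDisjoint B)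
    (hJ : J.card = 2 ^ w * L) :
    wExp unifWeight (fun x => ((satCount B J x).choose (10 * L) : ℝ) ^ 2) ≤ (1 / 3) ^ (5 * L) := by
  refine (wExp_mono unifWeight_nonneg fun x => choose_sq_le B J (10 * L) x).trans ?_
  rw [wExp_const_mul, wExp_prod_one_add_mul unifWeight_andUniform hB hdisj]
  have h := one_add_mul_half_pow_le 15 hJ.le
  push_cast at h
  refine (mul_le_mul_of_nonneg_left h (by positivity)).trans (le_of_eq ?_)
  have : (1 / 9 : ℝ) ^ (10 * L) = (1 / 3) ^ (5 * L) * (1 / 3) ^ (15 * L) := by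
    rw [← pow_add, show 5 * L + 15 * L = 2 * (10 * L) by ring, pow_mul (1 / 3 : ℝ) 2,
      show (1 / 3 : ℝ) ^ 2 = 1 / 9 by norm_num]
  have hone : (1 / 3 : ℝ) ^ (15 * L) * 3 ^ (15 * L) = 1 := by
    rw [← mul_pow, show (1 / 3 : ℝ) * 3 = 1 by norm_num, one_pow]
  rw [this, mul_assoc, hone, mul_one]

lemma wExp_zeroInd_le (hD0 : ∀ x, 0 ≤ D x) (hD : AndUniform D t) (hL : Even L)
    (hB : ∀ j ∈ J, (B j).card = w) (hdisj : (J : Set κ).PairwiseDisjoint B)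
    (hJ : J.card = 2 ^ w * L) (ht : w * (10 * L) ≤ t) :
    wExp D (zeroInd B J) ≤ (1 - (1 / 2) ^ w) ^ (2 ^ w * L) + (1 / 3) ^ (7 * L) := by
  have h1 := wExp_mono hD0 fun x => le_truncIE_of_even B J (hL.mul_left 10) x
  rw [wExp_truncIE hD hB hdisj ht] at h1
  have h2 := (abs_le.1 (truncBinom_error (w := w) (L := L) hJ.le (le_refl (10 * L)))).2
  rw [hJ] at h1 h2
  change wExp D (zeroInd B J) ≤ _ at h1
  linarith

lemma le_wExp_zeroInd (hD0 : ∀ x, 0 ≤ D x) (hD : AndUniform D t) (hL : Even L)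
    (hB : ∀ j ∈ J, (B j).card = w) (hdisj : (J : Set κ).PairwiseDisjoint B)
    (hJ : J.card = 2 ^ w * L) (ht : w * (10 * L + 1) ≤ t) :
    (1 - (1 / 2) ^ w) ^ (2 ^ w * L) - (1 / 3) ^ (7 * L) ≤ wExp D (zeroInd B J) := by
  have h1 := wExp_mono hD0 fun x => truncIE_le_of_odd B J (hL.mul_left 10).add_one x
  rw [wExp_truncIE hD hB hdisj ht] at h1
  have h2 := (abs_le.1 (truncBinom_error (w := w) (L := L) hJ.le (Nat.le_succ (10 * L)))).1
  rw [hJ] at h1 h2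
  change _ ≤ wExp D (zeroInd B J) at h1
  simp only [Nat.succ_eq_add_one] at h2
  linarith

lemma wExp_zeroInd_mul_le [DecidableEq κ] {J' : Finset κ} {h : ℕ} (hD0 : ∀ x, 0 ≤ D x)
    (hD : AndUniform D t) (hL : Even L) (hw : 1 ≤ w) (hB : ∀ j, (B j).card = w)
    (hdisj : (J : Set κ).PairwiseDisjoint B) (hdisj' : (J' : Set κ).PairwiseDisjoint B)
    (hJ : J.card = 2 ^ w * L) (hJ' : J'.card = 2 ^ w * L) (hJJ' : Disjoint J J')
    (hinter : ∀ i ∈ J, ∀ j ∈ J', (B i ∩ B j).card ≤ h) (hh : w * 2 ^ h ≤ 2 ^ w)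
    (ht : 2 * (w * (10 * L)) ≤ t) :
    wExp D (fun x => zeroInd B J x * zeroInd B J' x) ≤
      ((1 - (1 / 2) ^ w) ^ (2 ^ w * L)) ^ 2 * Real.exp (2 * L * w * 2 ^ h / 2 ^ w) +
        3 * (1 / 3) ^ (5 * L) := by
  set m := 10 * L with hm
  have hmEven : Even m := hL.mul_left 10
  set p : ℝ := (1 / 2) ^ w with hp
  have hp0 : 0 < p := by positivity
  have hp2 : p ≤ 1 / 2 := half_pow_le_half hw
  have hpN : p * 2 ^ w = 1 := by rw [hp, ← mul_pow]; norm_num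
  set δ : ℝ := w * 2 ^ h * p ^ 2 with hδ
  have hhR : (w : ℝ) * 2 ^ h ≤ 2 ^ w := by exact_mod_cast hh
  have hδp : δ ≤ p := by
    calc δ ≤ 2 ^ w * p ^ 2 := mul_le_mul_of_nonneg_right hhR (by positivity)
      _ = p * (p * 2 ^ w) := by ring
      _ = p := by rw [hpN, mul_one]
  have hjanson : wExp unifWeight (fun x => zeroInd B J x * zeroInd B J' x) ≤
      ((1 - p) ^ (2 ^ w * L)) ^ 2 * Real.exp (2 * L * w * 2 ^ h / 2 ^ w) := by
    have hnear : ∀ j ∈ J', ∑ i ∈ J with ¬ Disjoint (B j) (B i),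
        (1 / 2 : ℝ) ^ (B i ∪ B j).card ≤ δ := by
      intro j hj
      have hcount : #{i ∈ J | ¬ Disjoint (B j) (B i)} ≤ w := by
        calc #{i ∈ J | ¬ Disjoint (B j) (B i)} = ∑ _i ∈ J with ¬ Disjoint (B j) (B _i), 1 := by simp
          _ ≤ ∑ i ∈ J with ¬ Disjoint (B j) (B i), (B j ∩ B i).card := by
              refine sum_le_sum fun i hi => ?_
              have := (mem_filter.1 hi).2
              rw [not_disjoint_iff_nonempty_inter] at this
              exact card_pos.2 this
          _ = ({i ∈ J | ¬ Disjoint (B j) (B i)}.biUnion fun i => B j ∩ B i).card :=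
              (card_biUnion fun i hi k hk hik => (hdisj (mem_filter.1 hi).1 (mem_filter.1 hk).1
                hik).mono inter_subset_right inter_subset_right).symm
          _ ≤ (B j).card := card_le_card (biUnion_subset.2 fun _ _ => inter_subset_left)
          _ = w := hB j
      have hterm : ∀ i ∈ J.filter (fun i => ¬ Disjoint (B j) (B i)),
          (1 / 2 : ℝ) ^ (B i ∪ B j).card ≤ 2 ^ h * p ^ 2 := by
        intro i hi
        have h1 := card_union_add_card_inter (B i) (B j)
        rw [hB, hB] at h1
        have h2 := hinter i (mem_filter.1 hi).1 j hj
        have h3 : (1 / 2 : ℝ) ^ ((B i ∪ B j).card + (B i ∩ B j).card) = p ^ 2 := by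
          rw [h1, hp, ← pow_mul]; congr 1; ring
        rw [← h3, pow_add]
        have h4 : (1 : ℝ) ≤ (1 / 2) ^ (B i ∩ B j).card * 2 ^ h := by
          calc (1 : ℝ) = (1 / 2) ^ (B i ∩ B j).card * 2 ^ (B i ∩ B j).card := by
                rw [← mul_pow]; norm_num
            _ ≤ _ := mul_le_mul_of_nonneg_left (pow_le_pow_right₀ (by norm_num) h2) (by positivity)
        have h5 : (0 : ℝ) ≤ (1 / 2) ^ (B i ∪ B j).card := by positivity
        nlinarith
      refine (sum_le_sum hterm).trans ?_
      rw [sum_const, nsmul_eq_mul, hδ, mul_assoc]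
      exact mul_le_mul_of_nonneg_right (by exact_mod_cast hcount) (by positivity)
    have h1 := wExp_prod_union_le B hJJ' (fun j _ => hB j) hdisj' hnear hδp (by linarith)
      (by positivity)
    have h2 : wExp unifWeight (fun x => ∏ i ∈ J, (1 - andInd (B i) x)) = (1 - p) ^ (2 ^ w * L) := by
      have := wExp_prod_one_add_mul (D := unifWeight) unifWeight_andUniform
        (fun j (_ : j ∈ J) => hB j) hdisj (-1)
      simp only [neg_mul, one_mul, ← sub_eq_add_neg, hJ] at this
      exact this
    have h3 : (fun x => zeroInd B J x * zeroInd B J' x) =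
        fun x => ∏ i ∈ J ∪ J', (1 - andInd (B i) x) := by
      ext x
      rw [zeroInd_eq_prod, zeroInd_eq_prod, prod_union hJJ']
    rw [h3]
    refine h1.trans ?_
    rw [h2, hJ']
    have h4 : 1 - p + δ ≤ (1 - p) * Real.exp (2 * δ) := by
      have := Real.add_one_le_exp (2 * δ)
      have h0 : 0 ≤ δ := by positivity
      nlinarith
    have h5 : (1 - p + δ) ^ (2 ^ w * L) ≤
        (1 - p) ^ (2 ^ w * L) * Real.exp (2 * L * w * 2 ^ h / 2 ^ w) := by
      refine (pow_le_pow_left₀ (by have : 0 ≤ δ := by positivity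
                                   linarith) h4 _).trans (le_of_eq ?_)
      rw [mul_pow, ← Real.exp_nat_mul]
      congr 2
      rw [eq_div_iff (by positivity)]
      push_cast
      rw [hδ]
      linear_combination (2 * (L : ℝ) * w * 2 ^ h * (p * 2 ^ w + 1)) * hpN
    refine (mul_le_mul_of_nonneg_right h5 (pow_nonneg (by linarith) _)).trans (le_of_eq ?_)
    ring
  calc wExp D (fun x => zeroInd B J x * zeroInd B J' x)
      ≤ wExp D (fun x => truncIE B J m x * truncIE B J' m x) :=
        wExp_mono hD0 fun x => mul_le_mul (le_truncIE_of_even B J hmEven x)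
          (le_truncIE_of_even B J' hmEven x) (zeroInd_mem B J' x).1
          (truncIE_nonneg_of_even B J hmEven x)
    _ = wExp unifWeight (fun x => truncIE B J m x * truncIE B J' m x) :=
        wExp_truncIE_mul_truncIE_congr hD (unifWeight_andUniform t) (fun j => (hB j).le) ht
    _ ≤ wExp unifWeight (fun x => zeroInd B J x * zeroInd B J' x +
          3 / 2 * (((satCount B J x).choose m : ℝ) ^ 2 + ((satCount B J' x).choose m : ℝ) ^ 2)) := by
        refine wExp_mono unifWeight_nonneg fun x => ?_
        have a1 := truncIE_le_of_even B J hmEven x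
        have a2 := truncIE_le_of_even B J' hmEven x
        have z1 := zeroInd_mem B J x
        have z2 := zeroInd_mem B J' x
        have n1 := truncIE_nonneg_of_even B J hmEven x
        have n2 := truncIE_nonneg_of_even B J' hmEven x
        change _ ≤ zeroInd B J x + _ at a1
        change _ ≤ zeroInd B J' x + _ at a2
        have hsq : ∀ k : ℕ, (k : ℝ) ≤ (k : ℝ) ^ 2 := fun k => by
          exact_mod_cast Nat.le_self_pow two_ne_zero k
        have s1 := hsq ((satCount B J x).choose m)
        have s2 := hsq ((satCount B J' x).choose m)
        have c1 : (0 : ℝ) ≤ (satCount B J x).choose m := by positivity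
        have c2 : (0 : ℝ) ≤ (satCount B J' x).choose m := by positivity
        have hmul := mul_le_mul a1 a2 n2 (add_nonneg z1.1 c1)
        have b1 := mul_le_of_le_one_left c2 z1.2
        have b2 := mul_le_of_le_one_right c1 z2.2
        nlinarith [sq_nonneg (((satCount B J x).choose m : ℝ) - (satCount B J' x).choose m)]
    _ ≤ _ := by
        rw [wExp_add, wExp_const_mul, wExp_add]
        have e1 := wExp_choose_sq_le (fun j (_ : j ∈ J) => hB j) hdisj hJ
        have e2 := wExp_choose_sq_le (fun j (_ : j ∈ J') => hB j) hdisj' hJ'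
        linarith

end Bias
section Parameters

lemma mul_sq_le_two_pow {k : ℕ} (hk : 34 ≤ k) : 28800 * k ^ 2 ≤ 2 ^ k := by
  induction k, hk using Nat.le_induction with
  | base => norm_num
  | succ k hk ih =>
    rw [pow_succ 2 k]
    nlinarith

set_option maxHeartbeats 1000000 in
/-- Parameters of the construction: block width `w`, number `2 ^ w * L` of blocks per tuple,
intersection bound `h`, and number `u` of tuples. -/
lemma exists_parameters : ∃ n0 : ℕ, ∀ n : ℕ, n0 ≤ n → ∃ w L h u : ℕ,
    1 ≤ w ∧ Even L ∧ 6 ≤ L ∧ 2 ^ w * L * w ≤ n ∧ w * 2 ^ h ≤ 2 ^ w ∧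
    (2 * L * w * 2 ^ h / 2 ^ w : ℝ) ≤ 1 / 200 ∧
    (58 / 100 : ℝ) ≤ u * (1 - (1 / 2) ^ w) ^ (2 ^ w * L) ∧
    u * (1 - (1 / 2) ^ w) ^ (2 ^ w * L) ≤ (59 / 100 : ℝ) ∧
    u * 2 ^ w * 2 ^ w ≤ (2 ^ w * L) ^ h ∧ n * 2 ^ w ≤ u ∧ u ≤ n ^ 16 ∧
    (n : ℝ) ≤ 16 * (Real.logb 2 n) ^ 2 * 2 ^ w ∧
    (2 * (w * (10 * L + 1)) : ℝ) ≤ 100 * (Real.logb 2 n) ^ 2 := by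
  refine ⟨2 ^ 136, fun n hn => ?_⟩
  have hn0 : n ≠ 0 := by
    rintro rfl
    exact absurd hn (by norm_num)
  set l := Nat.log 2 n with hl
  have hl136 : 136 ≤ l := Nat.le_log_of_pow_le (by norm_num) hn
  have hln : 2 ^ l ≤ n := Nat.pow_log_le_self 2 hn0
  have hnl : n < 2 ^ (l + 1) := Nat.lt_pow_succ_log_self (by norm_num) n
  have hlogb : (l : ℝ) ≤ Real.logb 2 n := by
    rw [Real.le_logb_iff_rpow_le (by norm_num) (by positivity), Real.rpow_natCast]
    exact_mod_cast hln
  clear_value l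
  set r := Nat.clog 2 (4 * l ^ 2) with hr
  have hr1 : 4 * l ^ 2 ≤ 2 ^ r := Nat.le_pow_clog (by norm_num) _
  have hrl : r ≤ l / 2 := by
    rw [hr]
    apply Nat.clog_le_of_le_pow
    have := mul_sq_le_two_pow (k := l / 2) (by omega)
    have h2 : l ≤ 3 * (l / 2) := by omega
    nlinarith
  have hr2 : 2 ^ r ≤ 8 * l ^ 2 := by
    have h1 : 1 < 4 * l ^ 2 := by nlinarith
    have h2 := Nat.pow_pred_clog_lt_self (b := 2) (by norm_num) h1
    rw [← hr] at h2
    have h3 : r ≠ 0 := by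
      rintro h0
      rw [h0] at hr1
      omega
    obtain ⟨s, hs⟩ : ∃ s, r = s + 1 := ⟨r - 1, by omega⟩
    rw [hs, Nat.pred_succ] at h2
    rw [hs, pow_succ]
    omega
  clear_value r
  set w := l - r with hw
  have hwl : w ≤ l := Nat.sub_le _ _
  have hlw : l ≤ 2 * w := by omega
  have hsplit : 2 ^ w * 2 ^ r = 2 ^ l := by rw [← pow_add]; congr 1; omega
  clear_value w
  set h := w / 2 with hh
  have hh34 : 34 ≤ h := by omega
  have hwh : w ≤ 3 * h := by omega
  have hpoly : 3200 * w ^ 2 ≤ 2 ^ h := by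
    have := mul_sq_le_two_pow hh34
    nlinarith
  have hhh : 2 ^ h * 2 ^ h ≤ 2 ^ w := by
    rw [← pow_add]; exact Nat.pow_le_pow_right (by norm_num) (by omega)
  clear_value h
  set L := 4 * l with hL
  clear_value L
  set θ : ℝ := (1 - (1 / 2) ^ w) ^ (2 ^ w * L) with hθ
  have hθ9 : (1 / 9) ^ L ≤ θ := nine_pow_inv_le (by omega)
  have hθpos : 0 < θ := lt_of_lt_of_le (by positivity) hθ9
  have hθe : θ ≤ Real.exp (-L) := one_sub_half_pow_le_exp (by omega)
  clear_value θ
  have hθ2 : θ * 2 ^ L ≤ 1 := by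
    have h1 : (2 : ℝ) ^ L ≤ Real.exp L := by
      have h2 : (2 : ℝ) ≤ Real.exp 1 := by linarith [Real.add_one_le_exp (1 : ℝ)]
      calc (2 : ℝ) ^ L ≤ Real.exp 1 ^ L := pow_le_pow_left₀ (by norm_num) h2 _
        _ = Real.exp L := by rw [← Real.exp_nat_mul, mul_one]
    calc θ * 2 ^ L ≤ Real.exp (-L) * Real.exp L :=
          mul_le_mul hθe h1 (by positivity) (by positivity)
      _ = 1 := by rw [← Real.exp_add, neg_add_cancel, Real.exp_zero]
  have h2L : (2 : ℝ) ^ (2 * l + 2) ≤ 2 ^ L * (1 / 100) := by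
    have : (2 : ℝ) ^ L = 2 ^ (2 * l + 2) * 2 ^ (2 * l - 2) := by
      rw [← pow_add]; congr 1; omega
    rw [this]
    have h1 : (2 : ℝ) ^ 7 ≤ 2 ^ (2 * l - 2) := pow_le_pow_right₀ (by norm_num) (by omega)
    have h2 : (0 : ℝ) < 2 ^ (2 * l + 2) := by positivity
    nlinarith
  have hbig : (1 : ℝ) ≤ 2 ^ (2 * l + 2) := one_le_pow₀ (by norm_num)
  have hθsmall : θ * 2 ^ (2 * l + 2) ≤ 1 / 100 := by nlinarith
  set u := ⌊59 / 100 / θ⌋₊ with hu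
  have hu1 : u * θ ≤ 59 / 100 := by
    rw [← le_div_iff₀ hθpos]; exact Nat.floor_le (by positivity)
  have hu2 : 58 / 100 ≤ u * θ := by
    have h1 := Nat.lt_floor_add_one (59 / 100 / θ)
    rw [div_lt_iff₀ hθpos] at h1
    nlinarith
  have hul : u ≤ 2 ^ (16 * l) := by
    have h1 : (u : ℝ) * (1 / 9) ^ L ≤ 1 :=
      (mul_le_mul_of_nonneg_left hθ9 (by positivity)).trans (hu1.trans (by norm_num))
    have h2 : (u : ℝ) ≤ 9 ^ L := by
      rw [div_pow, one_pow, mul_one_div, div_le_one (by positivity)] at h1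
      exact h1
    have h3 : u ≤ 9 ^ L := by exact_mod_cast h2
    calc u ≤ 9 ^ L := h3
      _ ≤ 16 ^ L := Nat.pow_le_pow_left (by norm_num) _
      _ = 2 ^ (16 * l) := by rw [show 16 = 2 ^ 4 by rfl, ← pow_mul]; congr 1; omega
  clear_value u
  have hl1 : (1 : ℝ) ≤ l := by exact_mod_cast (show 1 ≤ l by omega)
  have hlsq : (l : ℝ) ^ 2 ≤ Real.logb 2 n ^ 2 := pow_le_pow_left₀ (by positivity) hlogb 2
  refine ⟨w, L, h, u, by omega, ⟨2 * l, by omega⟩, by omega, ?_, ?_, ?_, hθ ▸ hu2, hθ ▸ hu1, ?_, ?_, ?_,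
    ?_, ?_⟩
  · calc 2 ^ w * L * w ≤ 2 ^ w * (4 * l ^ 2) := by
          rw [mul_assoc]; refine Nat.mul_le_mul_left _ ?_; nlinarith
      _ ≤ 2 ^ w * 2 ^ r := Nat.mul_le_mul_left _ hr1
      _ ≤ n := hsplit.trans_le hln
  · refine le_trans (Nat.mul_le_mul_right _ ?_) hhh
    nlinarith
  · rw [div_le_iff₀ (by positivity)]
    have h1 : (2 : ℝ) ^ h * 2 ^ h ≤ 2 ^ w := by exact_mod_cast hhh
    have h2 : (3200 : ℝ) * w ^ 2 ≤ 2 ^ h := by exact_mod_cast hpoly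
    have h3 : (L : ℝ) ≤ 8 * w := by exact_mod_cast (show L ≤ 8 * w by omega)
    have h4 : (L : ℝ) * w ≤ 8 * w ^ 2 := by nlinarith [Nat.cast_nonneg (α := ℝ) w]
    have h5 : (0 : ℝ) < 2 ^ h := by positivity
    nlinarith
  · have h1 : 2 ^ (16 * l) ≤ 2 ^ (w * 32) := Nat.pow_le_pow_right (by norm_num) (by omega)
    calc u * 2 ^ w * 2 ^ w ≤ 2 ^ (w * 32) * 2 ^ w * 2 ^ w := by gcongr; exact hul.trans h1
      _ = (2 ^ w) ^ 34 := by rw [pow_mul]; ring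
      _ ≤ (2 ^ w) ^ h := Nat.pow_le_pow_right (by positivity) hh34
      _ ≤ (2 ^ w * L) ^ h := Nat.pow_le_pow_left (Nat.le_mul_of_pos_right _ (by omega)) _
  · have h1 : n * 2 ^ w ≤ 2 ^ (2 * l + 2) := by
      calc n * 2 ^ w ≤ 2 ^ (l + 1) * 2 ^ (l + 1) :=
            Nat.mul_le_mul hnl.le (Nat.pow_le_pow_right (by norm_num) (by omega))
        _ = 2 ^ (2 * l + 2) := by rw [← pow_add]; congr 1; omega
    refine h1.trans ?_
    have h2 : ((2 : ℝ) ^ (2 * l + 2)) ≤ u := by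
      refine le_of_mul_le_mul_right ?_ hθpos
      linarith
    exact_mod_cast h2
  · calc u ≤ 2 ^ (16 * l) := hul
      _ = (2 ^ l) ^ 16 := by rw [← pow_mul]; congr 1; omega
      _ ≤ n ^ 16 := Nat.pow_le_pow_left hln _
  · have h1 : n ≤ 16 * l ^ 2 * 2 ^ w := by
      rw [pow_succ, ← hsplit] at hnl
      nlinarith [Nat.zero_le (2 ^ w)]
    have h2 : (n : ℝ) ≤ 16 * l ^ 2 * 2 ^ w := by exact_mod_cast h1
    refine h2.trans ?_
    gcongr
  · have h1 : 2 * (w * (10 * L + 1)) ≤ 100 * l ^ 2 := by nlinarith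
    have h2 : (2 * (w * (10 * L + 1)) : ℝ) ≤ 100 * l ^ 2 := by exact_mod_cast h1
    linarith

end Parameters
section SecondMoment

variable {ι α : Type*} [Fintype ι] [DecidableEq ι] [Fintype α]

/-- First two Bonferroni inequalities for the event that all the indicators `A i` vanish. -/
lemma dPr_forall_eq_zero_bounds {D : α → ℝ} (hD0 : ∀ x, 0 ≤ D x) (hD1 : ∑ x, D x = 1)
    {A : ι → α → ℝ} (hA : ∀ i x, A i x = 0 ∨ A i x = 1) :
    1 - ∑ i, wExp D (A i) ≤ dPr D (fun x => ∀ i, A i x = 0) ∧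
    dPr D (fun x => ∀ i, A i x = 0) ≤
      1 - ∑ i, wExp D (A i) + 1 / 2 * ∑ i, ∑ j ∈ univ.erase i, wExp D (fun x => A i x * A j x) := by
  classical
  have hone : wExp D (fun _ => 1) = 1 := by simpa [wExp] using hD1
  have hE : wExp D (fun x => ∑ i, A i x) = ∑ i, wExp D (A i) := wExp_sum D univ A
  have hE2 : wExp D (fun x => ∑ i, ∑ j ∈ univ.erase i, A i x * A j x) =
      ∑ i, ∑ j ∈ univ.erase i, wExp D (fun x => A i x * A j x) := by
    rw [wExp_sum D univ fun i x => ∑ j ∈ univ.erase i, A i x * A j x]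
    exact sum_congr rfl fun i _ => wExp_sum D _ _
  have hnat : ∀ x, ∑ i, A i x = (#{i | A i x = 1} : ℝ) := by
    intro x
    rw [← sum_boole]
    refine sum_congr rfl fun i _ => ?_
    rcases hA i x with h | h <;> simp [h]
  have hoff : ∀ x, ∑ i, ∑ j ∈ univ.erase i, A i x * A j x = (∑ i, A i x) ^ 2 - ∑ i, A i x := by
    intro x
    rw [sq, sum_mul_sum, ← sum_sub_distrib]
    refine sum_congr rfl fun i _ => ?_
    rw [← add_sum_erase univ _ (mem_univ i)]
    rcases hA i x with h | h <;> simp [h]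
  have hiff : ∀ x, (∀ i, A i x = 0) ↔ #{i | A i x = 1} = 0 := by
    intro x
    rw [card_eq_zero, filter_eq_empty_iff]
    refine forall_congr' fun i => ?_
    rcases hA i x with h | h <;> simp [h]
  have hlin : 1 - ∑ i, wExp D (A i) = wExp D (fun x => 1 - ∑ i, A i x) := by
    rw [wExp_sub, hone, hE]
  rw [dPr_eq_wExp, hlin, ← hE2, ← wExp_const_mul, ← wExp_add]
  constructor
  · refine wExp_mono hD0 fun x => ?_
    rw [hnat]
    split_ifs with h
    · linarith [Nat.cast_nonneg (α := ℝ) #{i | A i x = 1}]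
    · rw [hiff] at h
      have : (1 : ℝ) ≤ #{i | A i x = 1} := by exact_mod_cast Nat.one_le_iff_ne_zero.2 h
      linarith
  · refine wExp_mono hD0 fun x => ?_
    rw [hoff, hnat]
    split_ifs with h
    · rw [hiff] at h
      simp [h]
    · rw [hiff] at h
      obtain h1 | h1 : #{i | A i x = 1} = 1 ∨ 2 ≤ #{i | A i x = 1} := by omega
      · simp [h1]
      · have : (2 : ℝ) ≤ #{i | A i x = 1} := by exact_mod_cast h1
        nlinarith

end SecondMoment

section Design

variable {β ι V : Type*} [Fintype β] [DecidableEq β] [Fintype ι] [DecidableEq ι] [Fintype V]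
  [DecidableEq V]

/-- A conjunction of disjunctions over tuples of disjoint blocks, with blocks from different
tuples nearly disjoint, is almost unbiased on distributions of sufficient independence. -/
lemma abs_dPr_forall_exists_sub_half_le {D : (β → Bool) → ℝ} (hD0 : ∀ x, 0 ≤ D x)
    (hD1 : ∑ x, D x = 1) {t w L h : ℕ} (hD : AndUniform D t) (hw : 1 ≤ w) (hL : Even L)
    (hL6 : 6 ≤ L) (hcardV : Fintype.card V = 2 ^ w * L) {B : ι × V → Finset β}
    (hB : ∀ p, (B p).card = w)
    (hdisj : ∀ i, Pairwise fun j k => Disjoint (B (i, j)) (B (i, k)))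
    (hinter : ∀ i i', i ≠ i' → ∀ j k, (B (i, j) ∩ B (i', k)).card ≤ h)
    (hh : w * 2 ^ h ≤ 2 ^ w) (hexp : (2 * L * w * 2 ^ h / 2 ^ w : ℝ) ≤ 1 / 200)
    (ht : 2 * (w * (10 * L + 1)) ≤ t)
    (hlow : (58 / 100 : ℝ) ≤ Fintype.card ι * (1 - (1 / 2) ^ w) ^ (2 ^ w * L))
    (hupp : Fintype.card ι * (1 - (1 / 2) ^ w) ^ (2 ^ w * L) ≤ (59 / 100 : ℝ)) :
    |dPr D (fun x => ∀ i, ∃ j, ∀ k ∈ B (i, j), x k = true) - 1 / 2| ≤ 1 / 9 := by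
  set J : ι → Finset (ι × V) := fun i => {i} ×ˢ univ with hJ
  set u : ℝ := (Fintype.card ι : ℝ) with hu
  set θ : ℝ := (1 - (1 / 2) ^ w) ^ (2 ^ w * L) with hθ
  have hθ9 : (1 / 9) ^ L ≤ θ := nine_pow_inv_le hw
  have hθ0 : 0 < θ := lt_of_lt_of_le (by positivity) hθ9
  have hu0 : 0 ≤ u := by positivity
  have hJcard : ∀ i, (J i).card = 2 ^ w * L := fun i => by simp [hJ, hcardV]
  have hJdisj : ∀ i, (J i : Set (ι × V)).PairwiseDisjoint B := by
    rintro i ⟨a, j⟩ ha ⟨b, k⟩ hb hne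
    simp only [hJ, coe_product, coe_singleton, Set.mem_prod, Set.mem_singleton_iff] at ha hb
    obtain ⟨rfl, -⟩ := ha
    obtain ⟨rfl, -⟩ := hb
    exact hdisj _ fun hjk => hne (by rw [hjk])
  have hevent : (fun x : β → Bool => ∀ i, ∃ j, ∀ k ∈ B (i, j), x k = true) =
      fun x => ∀ i, zeroInd B (J i) x = 0 := by
    ext x
    refine forall_congr' fun i => ?_
    simp [zeroInd, satCount, hJ, filter_eq_empty_iff]
  have hthird : (1 / 3 : ℝ) ^ L ≤ 1 / 700 := by
    refine (pow_le_pow_of_le_one (by norm_num) (by norm_num) hL6).trans ?_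
    norm_num
  have hfive : (1 / 3 : ℝ) ^ (5 * L) ≤ (1 / 3) ^ L :=
    pow_le_pow_of_le_one (by norm_num) (by norm_num) (by omega)
  have hε1 : (1 / 3 : ℝ) ^ (7 * L) ≤ 1 / 700 * θ :=
    (third_pow_le hw).trans (mul_le_mul_of_nonneg_right (hfive.trans hthird) hθ0.le)
  have hε2 : (1 / 3 : ℝ) ^ (5 * L) ≤ 1 / 700 * θ ^ 2 := by
    have h1 : (1 / 3 : ℝ) ^ (5 * L) = (1 / 3) ^ L * ((1 / 9) ^ L) ^ 2 := by
      rw [show (1 / 9 : ℝ) = (1 / 3) ^ 2 by norm_num, ← pow_mul, ← pow_mul, ← pow_add]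
      congr 1; ring
    rw [h1]
    exact mul_le_mul hthird (pow_le_pow_left₀ (by positivity) hθ9 2) (by positivity) (by norm_num)
  have hexp' : Real.exp (2 * L * w * 2 ^ h / 2 ^ w) ≤ 101 / 100 := by
    refine (Real.exp_le_exp.2 hexp).trans ?_
    have := Real.exp_bound_div_one_sub_of_interval (x := 1 / 200) (by norm_num) (by norm_num)
    exact this.trans (by norm_num)
  have hpair : ∀ i, ∀ i' ∈ univ.erase i,
      wExp D (fun x => zeroInd B (J i) x * zeroInd B (J i') x) ≤ 102 / 100 * θ ^ 2 := by
    intro i i' hi'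
    have hne : i ≠ i' := (ne_of_mem_erase hi').symm
    have hdisjJ : Disjoint (J i) (J i') := by
      rw [disjoint_left]
      rintro ⟨a, j⟩ ha hb
      simp only [hJ, mem_product, mem_singleton, mem_univ, and_true] at ha hb
      exact hne (ha.symm.trans hb)
    have h1 := wExp_zeroInd_mul_le hD0 hD hL hw hB (hJdisj i) (hJdisj i') (hJcard i) (hJcard i')
      hdisjJ (h := h) (by
        rintro ⟨a, j⟩ ha ⟨b, k⟩ hb
        simp only [hJ, mem_product, mem_singleton, mem_univ, and_true] at ha hb
        rw [ha, hb]
        exact hinter i i' hne j k) hh (le_trans (by gcongr; omega) ht)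
    have h2 : 0 ≤ θ ^ 2 := by positivity
    refine h1.trans ?_
    rw [← hθ]
    nlinarith
  have hzero : ∀ i x, zeroInd B (J i) x = 0 ∨ zeroInd B (J i) x = 1 := by
    intro i x
    unfold zeroInd
    split_ifs <;> simp
  obtain ⟨hl, hr⟩ := dPr_forall_eq_zero_bounds hD0 hD1 hzero
  have hsum1 : ∑ i, wExp D (zeroInd B (J i)) ≤ u * (701 / 700 * θ) := by
    rw [hu, ← nsmul_eq_mul, ← card_univ, ← sum_const]
    refine sum_le_sum fun i _ => ?_
    have := wExp_zeroInd_le hD0 hD hL (fun j _ => hB j) (hJdisj i) (hJcard i)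
      (le_trans (by nlinarith) ht)
    rw [← hθ] at this
    linarith
  have hsum2 : u * (699 / 700 * θ) ≤ ∑ i, wExp D (zeroInd B (J i)) := by
    rw [hu, ← nsmul_eq_mul, ← card_univ, ← sum_const]
    refine sum_le_sum fun i _ => ?_
    have := le_wExp_zeroInd hD0 hD hL (fun j _ => hB j) (hJdisj i) (hJcard i)
      (le_trans (by omega) ht)
    rw [← hθ] at this
    linarith
  have hsum3 : ∑ i, ∑ j ∈ univ.erase i, wExp D (fun x => zeroInd B (J i) x * zeroInd B (J j) x) ≤
      u * (u * (102 / 100 * θ ^ 2)) := by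
    rw [hu, ← nsmul_eq_mul, ← card_univ, ← sum_const]
    refine sum_le_sum fun i _ => ?_
    refine (sum_le_sum (hpair i)).trans ?_
    rw [sum_const, nsmul_eq_mul]
    refine mul_le_mul_of_nonneg_right ?_ (by positivity)
    exact_mod_cast card_le_card (erase_subset _ _)
  rw [hevent, abs_le]
  have hsq : (u * θ) ^ 2 ≤ (59 / 100) ^ 2 := pow_le_pow_left₀ (by positivity) hupp 2
  constructor
  · linarith
  · nlinarith

end Design
section Assembly

lemma exists_graph_tuples {w n L h u : ℕ} {V : Type*} [AddCommGroup V] [Fintype V] [DecidableEq V]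
    (e : Fin w × V ↪ Fin n) (hw : 1 ≤ w) (hL : 1 ≤ L) (hcardV : Fintype.card V = 2 ^ w * L)
    (hbad : u * 2 ^ w * 2 ^ w ≤ (2 ^ w * L) ^ h) (hnu : n * 2 ^ w ≤ u) :
    ∃ ω : ℕ → Fin w → V,
      (∀ i < u, ∀ j < u, i ≠ j → ∀ a b,
        (graphBlock e (ω i) a ∩ graphBlock e (ω j) b).card ≤ h) ∧
      ∀ Q : Finset (Fin n), Q.card ≤ 2 ^ w →
        ∑ i ∈ range u, excess e (ω i) Q ≤ 11 * u * Q.card := by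
  classical
  set v := Fintype.card V with hv
  have hv0 : 0 < v := Fintype.card_pos
  have hNv : 2 ^ w ≤ v := hcardV ▸ Nat.le_mul_of_pos_right _ hL
  have hcardG : Fintype.card (Fin w → V) = v ^ w := by simp [hv]
  set N : ℝ := 2 ^ w with hN
  have hN0 : 0 < N := by positivity
  have hN2 : 2 ≤ N := by
    simpa using pow_le_pow_right₀ (by norm_num : (1 : ℝ) ≤ 2) hw
  set Y : (Fin w → V) → Finset (Fin n) → ℝ := fun g Q =>
    if Q.Nonempty ∧ Q.card ≤ 2 ^ w then excess e g Q / (Q.card * N) else 0 with hY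
  have hY0 : ∀ g Q, 0 ≤ Y g Q := by
    intro g Q
    simp only [hY]
    split_ifs
    · exact div_nonneg (excess_nonneg e g Q) (by positivity)
    · exact le_rfl
  have hY1 : ∀ g Q, Y g Q ≤ 1 := by
    intro g Q
    simp only [hY]
    split_ifs
    · exact div_le_one_of_le₀ (excess_le e g Q) (by positivity)
    · norm_num
  have hmean : ∀ Q, ∑ g, Y g Q ≤ 2 / N * Fintype.card (Fin w → V) := by
    intro Q
    simp only [hY]
    split_ifs with hQ
    · have hQ0 : (0 : ℝ) < Q.card := by exact_mod_cast card_pos.2 hQ.1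
      rw [← sum_div, div_le_iff₀ (by positivity)]
      refine (sum_excess_le e (hQ.2.trans hNv)).trans (le_of_eq ?_)
      field_simp
    · rw [sum_const_zero]; positivity
  set R : (Fin w → V) → (Fin w → V) → Prop := fun g' g => ∃ d, h < #{a | g a - g' a = d} with hR
  set b : ℕ := v * (2 * v) ^ w / v ^ (h + 1) with hb
  have hRb : ∀ g', #{g | R g' g} ≤ b := by
    intro g'
    rw [hb, Nat.le_div_iff_mul_le (by positivity)]
    have := card_filter_agree_mul_le g' h
    convert this
  have hub : ((u * b : ℕ) : ℝ) * N ≤ Fintype.card (Fin w → V) := by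
    have h1 : b * v ^ (h + 1) ≤ v * (2 * v) ^ w := Nat.div_mul_le_self _ _
    have h2 : u * b * 2 ^ w ≤ v ^ w := by
      refine Nat.le_of_mul_le_mul_right ?_ (show 0 < v ^ (h + 1) by positivity)
      calc u * b * 2 ^ w * v ^ (h + 1) = u * 2 ^ w * (b * v ^ (h + 1)) := by ring
        _ ≤ u * 2 ^ w * (v * (2 * v) ^ w) := Nat.mul_le_mul_left _ h1
        _ = u * 2 ^ w * 2 ^ w * (v * v ^ w) := by rw [mul_pow]; ring
        _ ≤ v ^ h * (v * v ^ w) := Nat.mul_le_mul_right _ (hcardV ▸ hbad)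
        _ = v ^ w * v ^ (h + 1) := by ring
    rw [hcardG, hN]
    exact_mod_cast h2
  obtain ⟨ω, hω1, hω2⟩ := exists_seq_sum_le Y hY0 hY1 hN2 hmean Fintype.card_pos R hRb hub
  refine ⟨ω, ?_, ?_⟩
  · have hlt : ∀ j < u, ∀ i < j, ∀ a b,
        (graphBlock e (ω j) a ∩ graphBlock e (ω i) b).card ≤ h := by
      intro j hj i hi a b
      have h1 := hω1 j hj i hi
      simp only [hR, not_exists, not_lt] at h1
      exact (card_graphBlock_inter_le e (ω j) (ω i) a b).trans (h1 _)
    intro i hi j hj hne a b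
    rcases lt_or_gt_of_ne hne with h1 | h1
    · rw [inter_comm]; exact hlt j hj i h1 b a
    · exact hlt i hi j h1 a b
  · intro Q hQ
    rcases Q.eq_empty_or_nonempty with rfl | hne
    · simp [excess]
    have hQ0 : (0 : ℝ) < Q.card := by exact_mod_cast card_pos.2 hne
    have h1 := hω2 Q
    simp only [hY, hne, hQ, and_self, if_true] at h1
    rw [← sum_div, div_le_iff₀ (by positivity)] at h1
    have hlog : Real.log (Fintype.card (Finset (Fin n))) ≤ n := by
      rw [Fintype.card_finset, Fintype.card_fin, Nat.cast_pow, Real.log_pow]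
      have := Real.log_le_sub_one_of_pos (show (0 : ℝ) < (2 : ℕ) by norm_num)
      have h2 : Real.log (2 : ℕ) ≤ 1 := by refine this.trans ?_; norm_num
      exact mul_le_of_le_one_right (by positivity) h2
    have hnuR : (n : ℝ) * N ≤ u := by rw [hN]; exact_mod_cast hnu
    refine h1.trans ?_
    have h3 : (Real.log (Fintype.card (Finset (Fin n))) + 10 / N * u) * N ≤ 11 * u := by
      have h4 : (10 / N * u) * N = 10 * u := by field_simp
      rw [add_mul, h4]
      nlinarith
    calc _ = (Real.log (Fintype.card (Finset (Fin n))) + 10 / N * u) * N * Q.card := by ring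
      _ ≤ _ := mul_le_mul_of_nonneg_right h3 hQ0.le

lemma UndetC.exists_block {n u v : ℕ} {S : Fin u → Fin v → Finset (Fin n)} {Q : Finset (Fin n)}
    {x : {i : Fin n // i ∉ Q} → Bool} (hx : UndetC (Depth3 S) Q x) :
    ∃ i, (∃ j, ¬ Disjoint (S i j) Q ∧ ∀ k ∈ outside Q (S i j), x k = true) ∧
      ∀ j, Disjoint (S i j) Q → ¬ ∀ k ∈ outside Q (S i j), x k = true := by
  have key : ∀ y z : Fin n → Bool, (∀ i, ∀ h : i ∉ Q, y i = x ⟨i, h⟩) →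
      (∀ i, ∀ h : i ∉ Q, z i = x ⟨i, h⟩) → Depth3 S y → ¬ Depth3 S z →
      ∃ i, (∃ j, ¬ Disjoint (S i j) Q ∧ ∀ k ∈ outside Q (S i j), x k = true) ∧
        ∀ j, Disjoint (S i j) Q → ¬ ∀ k ∈ outside Q (S i j), x k = true := by
    intro y z hy hz hfy hfz
    unfold Depth3 at hfz
    push Not at hfz
    obtain ⟨i, hi⟩ := hfz
    have hdisj : ∀ j, Disjoint (S i j) Q → ¬ ∀ k ∈ outside Q (S i j), x k = true := by
      intro j hj hall
      obtain ⟨k, hk, hzk⟩ := hi j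
      have hkQ : k ∉ Q := disjoint_left.1 hj hk
      rw [hz k hkQ] at hzk
      exact hzk (hall ⟨k, hkQ⟩ (mem_subtype.2 hk))
    obtain ⟨j, hj⟩ := hfy i
    have hout : ∀ k ∈ outside Q (S i j), x k = true := by
      rintro ⟨k, hkQ⟩ hk
      rw [← hy k hkQ]
      exact hj k (mem_subtype.1 hk)
    exact ⟨i, ⟨j, fun hd => hdisj j hd hout, hout⟩, hdisj⟩
  obtain ⟨y, z, hy, hz, hne⟩ := hx
  by_cases hfy : Depth3 S y
  · exact key y z hy hz hfy fun hfz => hne (iff_of_true hfy hfz)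
  · exact key z y hz hy (by_contra fun hfz => hne (iff_of_false hfy hfz)) hfy

lemma dPr_le_sum {ι α : Type*} [Fintype ι] [Fintype α] {D : α → ℝ} (hD0 : ∀ x, 0 ≤ D x)
    {E : α → Prop} {E' : ι → α → Prop} (h : ∀ x, E x → ∃ i, E' i x) :
    dPr D E ≤ ∑ i, dPr D (E' i) := by
  classical
  simp only [dPr_eq_wExp]
  rw [← wExp_sum]
  refine wExp_mono hD0 fun x => ?_
  have hnn : ∀ i ∈ (univ : Finset ι), (0 : ℝ) ≤ if E' i x then 1 else 0 := fun i _ => by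
    split_ifs <;> norm_num
  split_ifs with hx
  · obtain ⟨i, hi⟩ := h x hx
    have := single_le_sum hnn (mem_univ i)
    rwa [if_pos hi] at this
  · exact sum_nonneg hnn

lemma dPr_le_one {α : Type*} [Fintype α] {D : α → ℝ} (hD0 : ∀ x, 0 ≤ D x) (hD1 : ∑ x, D x = 1)
    (E : α → Prop) : dPr D E ≤ 1 := by
  rw [← hD1]
  refine sum_le_sum fun x _ => ?_
  split_ifs
  · exact le_rfl
  · exact hD0 x

end Assembly

theorem statement1 :
    ∃ c : ℝ, 1 ≤ c ∧ ∃ n0 : ℕ, ∀ n : ℕ, n0 ≤ n →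
      ∃ u v : ℕ, 0 < u ∧ 0 < v ∧ ∃ S : Fin u → Fin v → Finset (Fin n),
        ((∑ i, ∑ j, ((S i j).card : ℝ)) ≤ (n : ℝ) ^ c) ∧
        (∀ D : (Fin n → Bool) → ℝ, (∀ x, 0 ≤ D x) → (∑ x, D x) = 1 →
            kWiseIndep D ⌈c * (Real.logb 2 n)^2⌉₊ →
            |dPr D (Depth3 S) - 1/2| ≤ 1/9) ∧
        (∀ q : ℕ, 1 ≤ q → q ≤ n → ∀ Q : Finset (Fin n), Q.card ≤ q →
          ∀ D : ({i : Fin n // i ∉ Q} → Bool) → ℝ, (∀ x, 0 ≤ D x) → (∑ x, D x) = 1 →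
            kWiseIndep D ⌈c * (Real.logb 2 n)^2⌉₊ →
            dPr D (UndetC (Depth3 S) Q) ≤ c * ((Real.logb 2 n)^2 / n) * q) := by
  obtain ⟨n0, hn0⟩ := exists_parameters
  refine ⟨10000, by norm_num, max n0 1, fun n hn => ?_⟩
  have hn1 : 1 ≤ n := (le_max_right _ _).trans hn
  obtain ⟨w, L, h, u, hw, hL, hL6, hwn, hh, hexp, hlow, hupp, hbad, hnu, hun, hnN, ht⟩ :=
    hn0 n ((le_max_left _ _).trans hn)
  set θ : ℝ := (1 - (1 / 2) ^ w) ^ (2 ^ w * L) with hθ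
  set v := 2 ^ w * L with hv
  have hv0 : 0 < v := Nat.mul_pos (by positivity) (by omega)
  have hu0 : 0 < u := lt_of_lt_of_le (by positivity) hnu
  have : NeZero v := ⟨hv0.ne'⟩
  have hcardV : Fintype.card (Fin v) = 2 ^ w * L := Fintype.card_fin v
  let e : Fin w × Fin v ↪ Fin n :=
    finProdFinEquiv.toEmbedding.trans (Fin.castLEEmb (by rw [mul_comm]; exact hwn))
  obtain ⟨ω, hω1, hω2⟩ := exists_graph_tuples e hw (by omega) hcardV hbad hnu
  have htceil : 2 * (w * (10 * L + 1)) ≤ ⌈(10000 : ℝ) * Real.logb 2 n ^ 2⌉₊ := by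
    have h1 := Nat.le_ceil ((10000 : ℝ) * Real.logb 2 n ^ 2)
    have h2 : ((2 * (w * (10 * L + 1)) : ℕ) : ℝ) ≤ ⌈(10000 : ℝ) * Real.logb 2 n ^ 2⌉₊ := by
      push_cast
      nlinarith [sq_nonneg (Real.logb 2 n)]
    exact_mod_cast h2
  refine ⟨u, v, hu0, hv0, fun i j => graphBlock e (ω i) j, ?_, ?_, ?_⟩
  · simp only [card_graphBlock, sum_const, card_univ, Fintype.card_fin, nsmul_eq_mul]
    have h1 : u * (v * w) ≤ n ^ 17 :=
      calc u * (v * w) ≤ n ^ 16 * n := Nat.mul_le_mul hun hwn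
        _ = n ^ 17 := (pow_succ n 16).symm
    have h2 : (u * (v * w) : ℝ) ≤ n ^ 17 := by exact_mod_cast h1
    refine h2.trans ?_
    rw [← Real.rpow_natCast]
    exact Real.rpow_le_rpow_of_exponent_le (by exact_mod_cast hn1) (by norm_num)
  · intro D hD0 hD1 hD
    refine abs_dPr_forall_exists_sub_half_le (ι := Fin u) (V := Fin v) (h := h)
      (B := fun p => graphBlock e (ω p.1) p.2) hD0 hD1 hD.andUniform hw hL hL6 hcardV
      (fun p => card_graphBlock e _ _) (fun i j k hjk => graphBlock_disjoint e (ω i) hjk)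
      (fun i i' hne j k => hω1 i i.2 i' i'.2 (fun hc => hne (Fin.ext hc)) j k) hh hexp htceil ?_ ?_
    · rw [Fintype.card_fin]; exact hlow
    · rw [Fintype.card_fin]; exact hupp
  · intro q hq1 _ Q hQ D hD0 hD1 hD
    have hn' : (0 : ℝ) < n := by exact_mod_cast hn1
    have hqR : (Q.card : ℝ) ≤ q := by exact_mod_cast hQ
    have hdensity : (1 : ℝ) / 2 ^ w ≤ 16 * (Real.logb 2 n ^ 2 / n) := by
      rw [div_le_iff₀ (by positivity), ← mul_div_assoc, div_mul_eq_mul_div, le_div_iff₀ hn',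
        one_mul]
      exact hnN
    have hlog0 : 0 ≤ Real.logb 2 n ^ 2 / n := by positivity
    rcases lt_or_ge (2 ^ w) Q.card with hbig | hsmall
    · refine (dPr_le_one hD0 hD1 _).trans ?_
      have h1 : (2 : ℝ) ^ w ≤ q := by
        exact_mod_cast hbig.le.trans hQ
      calc (1 : ℝ) = 1 / 2 ^ w * 2 ^ w := by field_simp
        _ ≤ 16 * (Real.logb 2 n ^ 2 / n) * q := by gcongr
        _ ≤ 10000 * (Real.logb 2 n ^ 2 / n) * q := by gcongr; norm_num
    · have hblock : ∀ i : Fin u, dPr D (fun x =>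
          (∃ j, ¬ Disjoint (graphBlock e (ω i) j) Q ∧
            ∀ k ∈ outside Q (graphBlock e (ω i) j), x k = true) ∧
          ∀ j, Disjoint (graphBlock e (ω i) j) Q →
            ¬ ∀ k ∈ outside Q (graphBlock e (ω i) j), x k = true) ≤
          20 * (1 / 2) ^ w * θ * excess e (ω i) Q := fun i =>
        dPr_block_undetermined_le hD0 hD.andUniform hw hL hcardV
          (le_trans (by nlinarith) htceil) (fun j => card_graphBlock e _ j)
          (fun j k hjk => graphBlock_disjoint e (ω i) hjk) hsmall
      refine (dPr_le_sum hD0 fun x hx => hx.exists_block).trans ?_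
      refine (sum_le_sum fun i _ => hblock i).trans ?_
      rw [← mul_sum, Fin.sum_univ_eq_sum_range fun i => excess e (ω i) Q]
      have hθ0 : 0 < θ := lt_of_lt_of_le (by positivity) (nine_pow_inv_le hw)
      calc 20 * (1 / 2) ^ w * θ * ∑ i ∈ range u, excess e (ω i) Q
          ≤ 20 * (1 / 2) ^ w * θ * (11 * u * Q.card) :=
            mul_le_mul_of_nonneg_left (hω2 Q hsmall) (by positivity)
        _ = 220 * (u * θ) * (1 / 2 ^ w) * Q.card := by rw [div_pow, one_pow]; ring
        _ ≤ 220 * (59 / 100) * (16 * (Real.logb 2 n ^ 2 / n)) * q := by gcongr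
        _ ≤ 10000 * (Real.logb 2 n ^ 2 / n) * q := by
            refine mul_le_mul_of_nonneg_right ?_ (by positivity)
            linarith
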